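/- arXiv:0709.2470 — 2 statements merged into one kernel-verified Lean document; each statement's English description precedes it below -/
import Mathlib

section
/- Every pair (A,B) of p×q complex matrices is simultaneously equivalent to a direct sum of pairs of the forms (I_n, J_n(λ)) with λ ∈ ℂ, (J_n(0), I_n), (F_n, G_n), (F_nᵀ, G_nᵀ); moreover this direct sum is determined by (A,B) uniquely up to permutation of summands (the multiset of canonical summands appearing is uniquely determined). -/
open Matrix

/-- A pair of `p × q` complex matrices (sizes are part of the data). -/
structure MatrixPair where
  p : ℕ
  q : ℕ
  A : Matrix (Fin p) (Fin q) ℂ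
  B : Matrix (Fin p) (Fin q) ℂ

namespace MatrixPair

/-- Block-diagonal direct sum of pairs: `(A,B) ⊕ (C,D) = (A ⊕ C, B ⊕ D)`. -/
noncomputable def dsum (P Q : MatrixPair) : MatrixPair :=
  ⟨P.p + Q.p, P.q + Q.q,
    Matrix.reindex finSumFinEquiv finSumFinEquiv (Matrix.fromBlocks P.A 0 0 Q.A),
    Matrix.reindex finSumFinEquiv finSumFinEquiv (Matrix.fromBlocks P.B 0 0 Q.B)⟩

/-- The empty (0×0) pair. -/
def zero : MatrixPair := ⟨0, 0, 0, 0⟩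

/-- Direct sum of a list of pairs. -/
noncomputable def dsumList (L : List MatrixPair) : MatrixPair := L.foldr dsum zero

/-- Simultaneous equivalence: `Q = (R⁻¹ P.A S, R⁻¹ P.B S)` for invertible `R`, `S`.
Here `R` (playing the role of `R⁻¹`) and `S` are given together with two-sided
inverses; over `ℂ` this forces `Q.p = P.p` and `Q.q = P.q`. -/
def SimEquiv (P Q : MatrixPair) : Prop :=
  ∃ (R : Matrix (Fin Q.p) (Fin P.p) ℂ) (R' : Matrix (Fin P.p) (Fin Q.p) ℂ)
    (S : Matrix (Fin P.q) (Fin Q.q) ℂ) (S' : Matrix (Fin Q.q) (Fin P.q) ℂ),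
    R * R' = 1 ∧ R' * R = 1 ∧ S * S' = 1 ∧ S' * S = 1 ∧
    Q.A = R * P.A * S ∧ Q.B = R * P.B * S

end MatrixPair

/-- The `n × n` Jordan block `J_n(λ)`: `λ` on the diagonal, `1` on the superdiagonal. -/
noncomputable def Jmat (n : ℕ) (l : ℂ) : Matrix (Fin n) (Fin n) ℂ :=
  Matrix.of fun i j => if (j : ℕ) = (i : ℕ) then l else if (j : ℕ) = (i : ℕ) + 1 then 1 else 0

/-- The `(n-1) × n` matrix `F_n` with `(F_n)_{i,j} = 1` iff `j = i`. -/
noncomputable def Fmat (n : ℕ) : Matrix (Fin (n - 1)) (Fin n) ℂ :=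
  Matrix.of fun i j => if (j : ℕ) = (i : ℕ) then 1 else 0

/-- The `(n-1) × n` matrix `G_n` with `(G_n)_{i,j} = 1` iff `j = i + 1`. -/
noncomputable def Gmat (n : ℕ) : Matrix (Fin (n - 1)) (Fin n) ℂ :=
  Matrix.of fun i j => if (j : ℕ) = (i : ℕ) + 1 then 1 else 0

/-- Canonical Kronecker pairs: `(I_n, J_n(λ))`, `(J_n(0), I_n)`, `(F_n, G_n)`, `(F_nᵀ, G_nᵀ)`. -/
noncomputable def KroneckerCanonical (P : MatrixPair) : Prop :=
  ∃ n : ℕ, 1 ≤ n ∧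
    ((∃ l : ℂ, P = ⟨n, n, 1, Jmat n l⟩) ∨
      P = ⟨n, n, Jmat n 0, 1⟩ ∨
      P = ⟨n - 1, n, Fmat n, Gmat n⟩ ∨
      P = ⟨n, n - 1, (Fmat n)ᵀ, (Gmat n)ᵀ⟩)

namespace Kron

section basics

variable {V W V' W' V'' W'' : Type}
  [AddCommGroup V] [Module ℂ V] [AddCommGroup W] [Module ℂ W]
  [AddCommGroup V'] [Module ℂ V'] [AddCommGroup W'] [Module ℂ W']
  [AddCommGroup V''] [Module ℂ V''] [AddCommGroup W''] [Module ℂ W'']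

/-- Isomorphism of pairs of linear maps. -/
def KIso (a b : V →ₗ[ℂ] W) (a' b' : V' →ₗ[ℂ] W') : Prop :=
  ∃ (e : V ≃ₗ[ℂ] V') (f : W ≃ₗ[ℂ] W'), (∀ v, f (a v) = a' (e v)) ∧ (∀ v, f (b v) = b' (e v))

theorem KIso.refl (a b : V →ₗ[ℂ] W) : KIso a b a b :=
  ⟨LinearEquiv.refl _ _, LinearEquiv.refl _ _, fun _ => rfl, fun _ => rfl⟩

theorem KIso.symm {a b : V →ₗ[ℂ] W} {a' b' : V' →ₗ[ℂ] W'} (h : KIso a b a' b') :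
    KIso a' b' a b := by
  obtain ⟨e, f, h1, h2⟩ := h
  refine ⟨e.symm, f.symm, fun v => ?_, fun v => ?_⟩
  · rw [LinearEquiv.symm_apply_eq, h1, LinearEquiv.apply_symm_apply]
  · rw [LinearEquiv.symm_apply_eq, h2, LinearEquiv.apply_symm_apply]

theorem KIso.trans {a b : V →ₗ[ℂ] W} {a' b' : V' →ₗ[ℂ] W'} {a'' b'' : V'' →ₗ[ℂ] W''}
    (h : KIso a b a' b') (h' : KIso a' b' a'' b'') : KIso a b a'' b'' := by
  obtain ⟨e, f, h1, h2⟩ := h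
  obtain ⟨e', f', h1', h2'⟩ := h'
  refine ⟨e.trans e', f.trans f', fun v => ?_, fun v => ?_⟩
  · simp [h1, h1']
  · simp [h2, h2']

theorem KIso.prod {V₁ W₁ V₁' W₁' : Type}
    [AddCommGroup V₁] [Module ℂ V₁] [AddCommGroup W₁] [Module ℂ W₁]
    [AddCommGroup V₁'] [Module ℂ V₁'] [AddCommGroup W₁'] [Module ℂ W₁']
    {a b : V →ₗ[ℂ] W} {a' b' : V' →ₗ[ℂ] W'} {c d : V₁ →ₗ[ℂ] W₁} {c' d' : V₁' →ₗ[ℂ] W₁'}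
    (h : KIso a b a' b') (h' : KIso c d c' d') :
    KIso (a.prodMap c) (b.prodMap d) (a'.prodMap c') (b'.prodMap d') := by
  obtain ⟨e, f, h1, h2⟩ := h
  obtain ⟨e', f', h1', h2'⟩ := h'
  refine ⟨e.prodCongr e', f.prodCongr f', fun v => ?_, fun v => ?_⟩
  · simp [h1, h1']
  · simp [h2, h2']

/-- The linear maps of a matrix pair. -/
noncomputable abbrev lA (P : MatrixPair) : (Fin P.q → ℂ) →ₗ[ℂ] (Fin P.p → ℂ) := P.A.mulVecLin
noncomputable abbrev lB (P : MatrixPair) : (Fin P.q → ℂ) →ₗ[ℂ] (Fin P.p → ℂ) := P.B.mulVecLin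

/-- splitting equivalence -/
noncomputable def splitE (m n : ℕ) : (Fin (m + n) → ℂ) ≃ₗ[ℂ] (Fin m → ℂ) × (Fin n → ℂ) :=
  (LinearEquiv.funCongrLeft ℂ ℂ finSumFinEquiv).trans (LinearEquiv.sumArrowLequivProdArrow _ _ ℂ ℂ)

theorem splitE_block {m n m' n' : ℕ} (A : Matrix (Fin m') (Fin m) ℂ) (B : Matrix (Fin n') (Fin n) ℂ)
    (v : Fin (m + n) → ℂ) :
    splitE m' n' ((Matrix.reindex finSumFinEquiv finSumFinEquiv
      (Matrix.fromBlocks A 0 0 B)).mulVec v) =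
      (A.mulVec (splitE m n v).1, B.mulVec (splitE m n v).2) := by
  have : v = (Sum.elim (splitE m n v).1 (splitE m n v).2) ∘ finSumFinEquiv.symm := by
    ext i
    obtain ⟨j, rfl⟩ := finSumFinEquiv.surjective i
    rcases j with j | j <;> simp [splitE, LinearEquiv.funCongrLeft, LinearMap.funLeft]
  generalize splitE m n v = x at this ⊢
  subst this
  rw [Matrix.reindex_apply, Matrix.submatrix_mulVec_equiv, Matrix.fromBlocks_mulVec]
  ext i <;> simp [splitE, LinearEquiv.funCongrLeft, LinearMap.funLeft, Function.comp_assoc]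

theorem KIso_dsum (P Q : MatrixPair) :
    KIso (lA (P.dsum Q)) (lB (P.dsum Q)) ((lA P).prodMap (lA Q)) ((lB P).prodMap (lB Q)) :=
  ⟨splitE P.q Q.q, splitE P.p Q.p, fun v => splitE_block P.A Q.A v,
    fun v => splitE_block P.B Q.B v⟩

theorem KIso_iff (P Q : MatrixPair) : P.SimEquiv Q ↔ KIso (lA P) (lB P) (lA Q) (lB Q) := by
  constructor
  · rintro ⟨R, R', S, S', h1, h2, h3, h4, hA, hB⟩
    refine ⟨LinearEquiv.ofLinearMap S'.mulVecLin S.mulVecLin ?_ ?_,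
      LinearEquiv.ofLinearMap R.mulVecLin R'.mulVecLin ?_ ?_, ?_, ?_⟩
    · rw [← Matrix.mulVecLin_mul, h4, Matrix.mulVecLin_one]
    · rw [← Matrix.mulVecLin_mul, h3, Matrix.mulVecLin_one]
    · rw [← Matrix.mulVecLin_mul, h1, Matrix.mulVecLin_one]
    · rw [← Matrix.mulVecLin_mul, h2, Matrix.mulVecLin_one]
    · intro v
      simp [hA, Matrix.mul_assoc, h3]
    · intro v
      simp [hB, Matrix.mul_assoc, h3]
  · rintro ⟨e, f, h1, h2⟩
    have key : ∀ (M : Matrix (Fin P.p) (Fin P.q) ℂ) (N : Matrix (Fin Q.p) (Fin Q.q) ℂ),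
        (∀ v, f (M.mulVecLin v) = N.mulVecLin (e v)) →
        N = LinearMap.toMatrix' (f : (Fin P.p → ℂ) →ₗ[ℂ] (Fin Q.p → ℂ)) * M *
          LinearMap.toMatrix' (e.symm : (Fin Q.q → ℂ) →ₗ[ℂ] (Fin P.q → ℂ)) := by
      intro M N h
      apply Matrix.toLin'.injective
      ext1 v
      rw [Matrix.toLin'_mul, Matrix.toLin'_mul]
      simp only [Matrix.toLin'_toMatrix']
      ext1
      have := h (e.symm (Pi.single v 1))
      simp only [LinearEquiv.apply_symm_apply] at this
      simpa using this.symm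
    refine ⟨LinearMap.toMatrix' f, LinearMap.toMatrix' f.symm, LinearMap.toMatrix' e.symm,
      LinearMap.toMatrix' e, ?_, ?_, ?_, ?_, key _ _ h1, key _ _ h2⟩ <;>
    · rw [← LinearMap.toMatrix'_comp]
      simp

/-- Decomposability into pairs from a class. -/
def Dec (𝒞 : MatrixPair → Prop) (a b : V →ₗ[ℂ] W) : Prop :=
  ∃ L : List MatrixPair, (∀ P ∈ L, 𝒞 P) ∧
    KIso a b (lA (MatrixPair.dsumList L)) (lB (MatrixPair.dsumList L))

variable {𝒞 𝒞' : MatrixPair → Prop}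

theorem Dec.of_iso {a b : V →ₗ[ℂ] W} {a' b' : V' →ₗ[ℂ] W'} (h : Dec 𝒞 a' b')
    (h' : KIso a b a' b') : Dec 𝒞 a b := by
  obtain ⟨L, h1, h2⟩ := h
  exact ⟨L, h1, h'.trans h2⟩

theorem KIso_subsing [Subsingleton V] [Subsingleton W] [Subsingleton V'] [Subsingleton W']
    (a b : V →ₗ[ℂ] W) (a' b' : V' →ₗ[ℂ] W') : KIso a b a' b' :=
  ⟨LinearEquiv.ofSubsingleton _ _, LinearEquiv.ofSubsingleton _ _,
    fun _ => Subsingleton.elim _ _, fun _ => Subsingleton.elim _ _⟩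

theorem Dec.subsing [Subsingleton V] [Subsingleton W] (a b : V →ₗ[ℂ] W) : Dec 𝒞 a b := by
  refine ⟨[], by simp, ?_⟩
  have : Subsingleton (Fin (MatrixPair.dsumList []).p → ℂ) :=
    inferInstanceAs (Subsingleton (Fin 0 → ℂ))
  have : Subsingleton (Fin (MatrixPair.dsumList []).q → ℂ) :=
    inferInstanceAs (Subsingleton (Fin 0 → ℂ))
  exact KIso_subsing _ _ _ _

theorem KIso_prod_subsing [Subsingleton V'] [Subsingleton W'] (a b : V →ₗ[ℂ] W)
    (a' b' : V' →ₗ[ℂ] W') : KIso (a.prodMap a') (b.prodMap b') a b := by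
  refine ⟨⟨LinearMap.fst ℂ V V', fun v => (v, 0), fun v => ?_, fun v => rfl⟩,
    ⟨LinearMap.fst ℂ W W', fun v => (v, 0), fun v => ?_, fun v => rfl⟩, fun v => rfl, fun v => rfl⟩
  · exact Prod.ext rfl (Subsingleton.elim _ _)
  · exact Prod.ext rfl (Subsingleton.elim _ _)

theorem KIso_prod_comm (a b : V →ₗ[ℂ] W)
    (a' b' : V' →ₗ[ℂ] W') :
    KIso (a.prodMap a') (b.prodMap b') (a'.prodMap a) (b'.prodMap b) :=
  ⟨LinearEquiv.prodComm _ _ _, LinearEquiv.prodComm _ _ _, fun _ => rfl, fun _ => rfl⟩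

theorem KIso_prod_assoc (a b : V →ₗ[ℂ] W)
    (a' b' : V' →ₗ[ℂ] W') (a'' b'' : V'' →ₗ[ℂ] W'') :
    KIso ((a.prodMap a').prodMap a'') ((b.prodMap b').prodMap b'')
      (a.prodMap (a'.prodMap a'')) (b.prodMap (b'.prodMap b'')) :=
  ⟨LinearEquiv.prodAssoc _ _ _ _, LinearEquiv.prodAssoc _ _ _ _, fun _ => rfl, fun _ => rfl⟩

theorem Dec.single {P : MatrixPair} (h : 𝒞 P) : Dec 𝒞 (lA P) (lB P) := by
  refine ⟨[P], by simpa using h, ?_⟩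
  refine KIso.symm ((KIso_dsum P MatrixPair.zero).trans ?_)
  have : Subsingleton (Fin MatrixPair.zero.p → ℂ) := inferInstanceAs (Subsingleton (Fin 0 → ℂ))
  have : Subsingleton (Fin MatrixPair.zero.q → ℂ) := inferInstanceAs (Subsingleton (Fin 0 → ℂ))
  exact KIso_prod_subsing _ _ _ _

theorem KIso_append (L L' : List MatrixPair) :
    KIso (lA (MatrixPair.dsumList (L ++ L'))) (lB (MatrixPair.dsumList (L ++ L')))
      ((lA (MatrixPair.dsumList L)).prodMap (lA (MatrixPair.dsumList L')))
      ((lB (MatrixPair.dsumList L)).prodMap (lB (MatrixPair.dsumList L'))) := by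
  induction L with
  | nil =>
    have : Subsingleton (Fin (MatrixPair.dsumList []).p → ℂ) :=
      inferInstanceAs (Subsingleton (Fin 0 → ℂ))
    have : Subsingleton (Fin (MatrixPair.dsumList []).q → ℂ) :=
      inferInstanceAs (Subsingleton (Fin 0 → ℂ))
    exact ((KIso_prod_comm _ _ _ _).trans (KIso_prod_subsing _ _ _ _)).symm
  | cons P L ih =>
    exact (KIso_dsum P (MatrixPair.dsumList (L ++ L'))).trans
      (((KIso.refl _ _).prod ih).trans ((KIso_prod_assoc _ _ _ _ _ _).symm.trans
        ((KIso_dsum P (MatrixPair.dsumList L)).symm.prod (KIso.refl _ _))))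

theorem Dec.prod {a b : V →ₗ[ℂ] W} {a' b' : V' →ₗ[ℂ] W'} (h : Dec 𝒞 a b) (h' : Dec 𝒞 a' b') :
    Dec 𝒞 (a.prodMap a') (b.prodMap b') := by
  obtain ⟨L, h1, h2⟩ := h
  obtain ⟨L', h1', h2'⟩ := h'
  refine ⟨L ++ L', ?_, (h2.prod h2').trans (KIso_append L L').symm⟩
  intro P hP
  rcases List.mem_append.1 hP with h | h
  · exact h1 P h
  · exact h1' P h

theorem Dec.induct (Q : MatrixPair → Prop) (h0 : Q MatrixPair.zero)
    (hs : ∀ P P', 𝒞 P → Q P' → Q (P.dsum P')) (L : List MatrixPair) (hL : ∀ P ∈ L, 𝒞 P) :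
    Q (MatrixPair.dsumList L) := by
  induction L with
  | nil => exact h0
  | cons P L ih =>
    exact hs P _ (hL P (by simp)) (ih fun P hP => hL P (by simp [hP]))

/-- Functorial change of the class of blocks. -/
theorem Dec.list_map (T : MatrixPair → MatrixPair) (hT0 : T MatrixPair.zero = MatrixPair.zero)
    (hT : ∀ P Q, T (P.dsum Q) = (T P).dsum (T Q))
    (h : ∀ P, 𝒞 P → Dec 𝒞' (lA (T P)) (lB (T P)))
    (L : List MatrixPair) (hL : ∀ P ∈ L, 𝒞 P) :
    Dec 𝒞' (lA (T (MatrixPair.dsumList L))) (lB (T (MatrixPair.dsumList L))) := by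
  refine Dec.induct (𝒞 := 𝒞) (fun P => Dec 𝒞' (lA (T P)) (lB (T P))) ?_ ?_ L hL
  · rw [hT0]
    have : Subsingleton (Fin MatrixPair.zero.p → ℂ) := inferInstanceAs (Subsingleton (Fin 0 → ℂ))
    have : Subsingleton (Fin MatrixPair.zero.q → ℂ) := inferInstanceAs (Subsingleton (Fin 0 → ℂ))
    exact Dec.subsing _ _
  · intro P P' hP hP'
    rw [hT]
    exact ((h P hP).prod hP').of_iso (KIso_dsum _ _)

/-- linear substitution -/
noncomputable def subst (α β γ δ : ℂ) (P : MatrixPair) : MatrixPair :=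
  ⟨P.p, P.q, α • P.A + β • P.B, γ • P.A + δ • P.B⟩

theorem subst_dsum (α β γ δ : ℂ) (P Q : MatrixPair) :
    subst α β γ δ (P.dsum Q) = (subst α β γ δ P).dsum (subst α β γ δ Q) := by
  have key : ∀ (α β : ℂ), α • Matrix.reindex finSumFinEquiv finSumFinEquiv
        (Matrix.fromBlocks P.A 0 0 Q.A) + β • Matrix.reindex finSumFinEquiv finSumFinEquiv
        (Matrix.fromBlocks P.B 0 0 Q.B)
      = Matrix.reindex finSumFinEquiv finSumFinEquiv
        (Matrix.fromBlocks (α • P.A + β • P.B) 0 0 (α • Q.A + β • Q.B)) := by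
    intro α β
    have : Matrix.fromBlocks (α • P.A + β • P.B) 0 0 (α • Q.A + β • Q.B) =
        α • Matrix.fromBlocks P.A 0 0 Q.A + β • Matrix.fromBlocks P.B 0 0 Q.B := by
      simp [Matrix.fromBlocks_smul, Matrix.fromBlocks_add]
    rw [this]
    rfl
  exact congrArg₂ (MatrixPair.mk (P.p + Q.p) (P.q + Q.q)) (key α β) (key γ δ)

theorem subst_zero (α β γ δ : ℂ) : subst α β γ δ MatrixPair.zero = MatrixPair.zero := by
  exact congrArg₂ (MatrixPair.mk 0 0) (Subsingleton.elim _ _) (Subsingleton.elim _ _)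

theorem Dec.subst {a b : V →ₗ[ℂ] W} (h : Dec 𝒞 a b) (α β γ δ : ℂ)
    (h' : ∀ P, 𝒞 P → Dec 𝒞' (lA (Kron.subst α β γ δ P)) (lB (Kron.subst α β γ δ P))) :
    Dec 𝒞' (α • a + β • b) (γ • a + δ • b) := by
  obtain ⟨L, hL, e, f, h1, h2⟩ := h
  refine (Dec.list_map _ (subst_zero α β γ δ) (subst_dsum α β γ δ) h' L hL).of_iso ?_
  refine ⟨e, f, fun v => ?_, fun v => ?_⟩
  · change f (α • a v + β • b v) = (α • (MatrixPair.dsumList L).A +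
      β • (MatrixPair.dsumList L).B).mulVec (e v)
    rw [map_add, map_smul, map_smul, h1, h2, Matrix.add_mulVec, Matrix.smul_mulVec,
      Matrix.smul_mulVec]
    rfl
  · change f (γ • a v + δ • b v) = (γ • (MatrixPair.dsumList L).A +
      δ • (MatrixPair.dsumList L).B).mulVec (e v)
    rw [map_add, map_smul, map_smul, h1, h2, Matrix.add_mulVec, Matrix.smul_mulVec,
      Matrix.smul_mulVec]
    rfl

/-- transposition -/
noncomputable def tr (P : MatrixPair) : MatrixPair := ⟨P.q, P.p, P.Aᵀ, P.Bᵀ⟩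

theorem tr_dsum (P Q : MatrixPair) : tr (P.dsum Q) = (tr P).dsum (tr Q) := by
  have key : ∀ {m n m' n' : ℕ} (A : Matrix (Fin m) (Fin n) ℂ) (B : Matrix (Fin m') (Fin n') ℂ),
      (Matrix.reindex finSumFinEquiv finSumFinEquiv (Matrix.fromBlocks A 0 0 B))ᵀ =
        Matrix.reindex finSumFinEquiv finSumFinEquiv (Matrix.fromBlocks Aᵀ 0 0 Bᵀ) := by
    intro m n m' n' A B
    rw [Matrix.transpose_reindex, Matrix.fromBlocks_transpose]
    simp
  exact congrArg₂ (MatrixPair.mk (P.q + Q.q) (P.p + Q.p)) (key _ _) (key _ _)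

theorem tr_zero : tr MatrixPair.zero = MatrixPair.zero := by
  simp [tr, MatrixPair.zero]

theorem tr_sim {P Q : MatrixPair} (h : P.SimEquiv Q) : (tr P).SimEquiv (tr Q) := by
  obtain ⟨R, R', S, S', h1, h2, h3, h4, hA, hB⟩ := h
  refine ⟨Sᵀ, S'ᵀ, Rᵀ, R'ᵀ, ?_, ?_, ?_, ?_, ?_, ?_⟩
  · change Sᵀ * S'ᵀ = 1
    rw [← Matrix.transpose_mul, h4, Matrix.transpose_one]
  · change S'ᵀ * Sᵀ = 1
    rw [← Matrix.transpose_mul, h3, Matrix.transpose_one]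
  · change Rᵀ * R'ᵀ = 1
    rw [← Matrix.transpose_mul, h2, Matrix.transpose_one]
  · change R'ᵀ * Rᵀ = 1
    rw [← Matrix.transpose_mul, h1, Matrix.transpose_one]
  · change Q.Aᵀ = Sᵀ * P.Aᵀ * Rᵀ
    rw [hA, Matrix.transpose_mul, Matrix.transpose_mul, Matrix.mul_assoc]
  · change Q.Bᵀ = Sᵀ * P.Bᵀ * Rᵀ
    rw [hB, Matrix.transpose_mul, Matrix.transpose_mul, Matrix.mul_assoc]

theorem Dec.tr {P : MatrixPair} (h : Dec 𝒞 (lA P) (lB P))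
    (h' : ∀ P, 𝒞 P → Dec 𝒞' (lA (Kron.tr P)) (lB (Kron.tr P))) :
    Dec 𝒞' (lA (Kron.tr P)) (lB (Kron.tr P)) := by
  obtain ⟨L, hL, h1⟩ := h
  exact (Dec.list_map _ tr_zero tr_dsum h' L hL).of_iso
    ((KIso_iff _ _).1 (tr_sim ((KIso_iff _ _).2 h1)))

/-- Passing to matrices. -/
theorem exists_pair [FiniteDimensional ℂ V] [FiniteDimensional ℂ W] (a b : V →ₗ[ℂ] W) :
    ∃ P : MatrixPair, P.p = Module.finrank ℂ W ∧ P.q = Module.finrank ℂ V ∧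
      KIso a b (lA P) (lB P) := by
  let bV := Module.finBasis ℂ V
  let bW := Module.finBasis ℂ W
  refine ⟨⟨_, _, LinearMap.toMatrix bV bW a, LinearMap.toMatrix bV bW b⟩, rfl, rfl,
    bV.equivFun, bW.equivFun, fun v => ?_, fun v => ?_⟩
  · exact (LinearMap.toMatrix_mulVec_repr bV bW a v).symm
  · exact (LinearMap.toMatrix_mulVec_repr bV bW b v).symm

end basics

section ext

variable {V W V' W' U C : Type}
  [AddCommGroup V] [Module ℂ V] [AddCommGroup W] [Module ℂ W]
  [AddCommGroup V'] [Module ℂ V'] [AddCommGroup W'] [Module ℂ W']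
  [AddCommGroup U] [Module ℂ U] [AddCommGroup C] [Module ℂ C]
  {𝒞 : MatrixPair → Prop}

/-- `(v, c) ↦ (a v + s c, 0)` -/
noncomputable def extA (a : V →ₗ[ℂ] W) (s : C →ₗ[ℂ] W) : V × C →ₗ[ℂ] W × C :=
  (LinearMap.inl ℂ W C).comp (a.coprod s)

/-- `(v, c) ↦ (b v, c)` -/
noncomputable def extB (C : Type) [AddCommGroup C] [Module ℂ C] (b : V →ₗ[ℂ] W) :
    V × C →ₗ[ℂ] W × C := b.prodMap LinearMap.id

@[simp] theorem extA_apply (a : V →ₗ[ℂ] W) (s : C →ₗ[ℂ] W) (x : V × C) :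
    extA a s x = (a x.1 + s x.2, 0) := by simp [extA]

@[simp] theorem extB_apply (b : V →ₗ[ℂ] W) (x : V × C) :
    extB C b x = (b x.1, x.2) := by simp [extB]

theorem ext_change (a b : V →ₗ[ℂ] W) (s0 : C →ₗ[ℂ] W) (π : W →ₗ[ℂ] C)
    (h1 : ∀ c, π (s0 c) = c) (h2 : ∀ w, π w = 0 ↔ w ∈ LinearMap.range a)
    (s : U →ₗ[ℂ] W) (hs : LinearMap.range a ⊔ LinearMap.range s = ⊤) :
    ∃ K : Submodule ℂ U, KIso (extA a s) (extB U b)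
      ((extA a s0).prodMap (0 : K →ₗ[ℂ] K)) ((extB C b).prodMap (LinearMap.id : K →ₗ[ℂ] K)) := by
  let φ : U →ₗ[ℂ] C := π ∘ₗ s
  have hφ : Function.Surjective φ := by
    intro c
    have : s0 c ∈ LinearMap.range a ⊔ LinearMap.range s := hs ▸ Submodule.mem_top
    obtain ⟨x, hx, y, ⟨u, rfl⟩, hxy⟩ := Submodule.mem_sup.1 this
    refine ⟨u, ?_⟩
    have := congrArg π hxy
    rw [map_add, (h2 x).2 hx, h1, zero_add] at this
    exact this
  obtain ⟨r, hr⟩ := LinearMap.exists_rightInverse_of_surjective φ (LinearMap.range_eq_top.2 hφ)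
  have hr' : ∀ c, φ (r c) = c := fun c => by
    have := LinearMap.congr_fun hr c
    simpa using this
  have hmem : ∀ u, (s - s0 ∘ₗ φ) u ∈ LinearMap.range a := by
    intro u
    rw [← h2]
    simp [h1, φ]
  obtain ⟨f, hf⟩ := Module.projective_lifting_property a.rangeRestrict
    ((s - s0 ∘ₗ φ).codRestrict (LinearMap.range a) hmem) a.surjective_rangeRestrict
  have hf' : ∀ u, a (f u) = s u - s0 (φ u) := by
    intro u
    have := congrArg Subtype.val (LinearMap.congr_fun hf u)
    simpa using this
  let K := LinearMap.ker φ
  have hk : ∀ u, (LinearMap.id - r ∘ₗ φ : U →ₗ[ℂ] U) u ∈ K := by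
    intro u
    simp [K, hr']
  let k : U →ₗ[ℂ] K := (LinearMap.id - r ∘ₗ φ : U →ₗ[ℂ] U).codRestrict K hk
  have hk' : ∀ u, ((k u : K) : U) = u - r (φ u) := fun u => by simp [k]
  have hK : ∀ x : K, φ (x : U) = 0 := fun x => x.2
  -- general shear equivalence
  have mk : ∀ {X : Type} [AddCommGroup X] [Module ℂ X] (g : U →ₗ[ℂ] X),
      ∃ e : (X × U) ≃ₗ[ℂ] ((X × C) × K), ∀ x u, e (x, u) = ((x + g u, φ u), k u) := by
    intro X _ _ g
    let F : (X × U) →ₗ[ℂ] ((X × C) × K) :=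
      (((LinearMap.fst ℂ X U) + g ∘ₗ LinearMap.snd ℂ X U).prod (φ ∘ₗ LinearMap.snd ℂ X U)).prod
        (k ∘ₗ LinearMap.snd ℂ X U)
    have hF : ∀ x u, F (x, u) = ((x + g u, φ u), k u) := fun x u => by simp [F]
    refine ⟨LinearEquiv.ofBijective F ⟨?_, ?_⟩, fun x u => hF x u⟩
    · rw [injective_iff_map_eq_zero]
      rintro ⟨x, u⟩ h
      rw [hF] at h
      simp only [Prod.mk_eq_zero] at h
      obtain ⟨⟨h1, h2⟩, h3⟩ := h
      have h4 := hk' u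
      rw [h3, h2] at h4
      have hu : u = 0 := by simpa using h4.symm
      subst hu
      simpa using h1
    · rintro ⟨⟨x, c⟩, y⟩
      have e1 : φ (r c + y) = c := by rw [map_add, hr', hK, add_zero]
      refine ⟨(x - g (r c + y), r c + y), ?_⟩
      rw [hF, e1, sub_add_cancel]
      congr 1
      apply Subtype.ext
      rw [hk', e1]
      simp
  obtain ⟨e, he⟩ := mk f
  obtain ⟨g, hg⟩ := mk (b ∘ₗ f)
  refine ⟨K, e, g, ?_, ?_⟩
  · rintro ⟨v, u⟩
    rw [he, extA_apply, hg]
    simp [hf']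
    abel
  · rintro ⟨v, u⟩
    rw [he, extB_apply, hg]
    simp

theorem decompose (a b : V →ₗ[ℂ] W) :
    ∃ (U : Submodule ℂ V) (T : Submodule ℂ W)
      (s : U →ₗ[ℂ] LinearMap.range a)
      (a1 b1 : (LinearMap.range a).comap b →ₗ[ℂ] LinearMap.range a),
      (∀ v, (a1 v : W) = a v) ∧ (∀ v, (b1 v : W) = b v) ∧
      (LinearMap.range a1 ⊔ LinearMap.range s = ⊤) ∧
      (Function.Surjective b → Subsingleton T) ∧
      KIso a b ((extA a1 s).prodMap (0 : PUnit →ₗ[ℂ] T)) ((extB U b1).prodMap 0) := by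
  set W1 := LinearMap.range a with hW1
  obtain ⟨U, hU⟩ := Submodule.exists_isCompl (W1.comap b)
  obtain ⟨T, hT⟩ := Submodule.exists_isCompl (W1 ⊔ LinearMap.range b)
  have ha : ∀ v, a v ∈ W1 := fun v => ⟨v, rfl⟩
  let s : U →ₗ[ℂ] W1 := (a ∘ₗ U.subtype).codRestrict W1 fun u => ha _
  let a1 : W1.comap b →ₗ[ℂ] W1 := (a ∘ₗ (W1.comap b).subtype).codRestrict W1 fun u => ha _
  let b1 : W1.comap b →ₗ[ℂ] W1 := (b ∘ₗ (W1.comap b).subtype).codRestrict W1 fun u => u.2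
  refine ⟨U, T, s, a1, b1, fun v => rfl, fun v => rfl, ?_, ?_, ?_⟩
  · rw [eq_top_iff]
    rintro ⟨w, v, rfl⟩ -
    have : v ∈ W1.comap b ⊔ U := hU.sup_eq_top ▸ Submodule.mem_top
    obtain ⟨x, hx, y, hy, rfl⟩ := Submodule.mem_sup.1 this
    refine Submodule.mem_sup.2 ⟨a1 ⟨x, hx⟩, ⟨_, rfl⟩, s ⟨y, hy⟩, ⟨_, rfl⟩, ?_⟩
    apply Subtype.ext
    simp [a1, s]
  · intro hb
    rw [LinearMap.range_eq_top.2 hb, sup_top_eq] at hT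
    have hT' := eq_bot_of_top_isCompl hT
    subst hT'
    infer_instance
  · apply KIso.symm
    let e0 := Submodule.prodEquivOfIsCompl _ _ hU
    have he0 : ∀ v u, e0 (v, u) = (v : V) + u := fun v u => by simp [e0]
    let F : ((W1 × U) × T) →ₗ[ℂ] W :=
      (W1.subtype.coprod (b ∘ₗ U.subtype)).coprod T.subtype
    have hF : ∀ w u t, F ((w, u), t) = (w : W) + b u + t := fun w u t => by simp [F]
    have hFb : Function.Bijective F := by
      constructor
      · rw [injective_iff_map_eq_zero]
        rintro ⟨⟨w, u⟩, t⟩ h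
        rw [hF] at h
        have ht : (t : W) = 0 := by
          have h1 : (t : W) ∈ W1 ⊔ LinearMap.range b := by
            have : (t : W) = - ((w : W) + b u) := (neg_eq_of_add_eq_zero_right h).symm
            rw [this]
            exact neg_mem (Submodule.add_mem_sup w.2 ⟨_, rfl⟩)
          have := Submodule.disjoint_def.1 hT.disjoint _ h1 t.2
          exact this
        rw [ht, add_zero] at h
        have hu : (u : V) = 0 := by
          refine Submodule.disjoint_def.1 hU.disjoint _ ?_ u.2
          have : b u = - (w : W) := (neg_eq_of_add_eq_zero_right h).symm
          rw [Submodule.mem_comap, this]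
          exact neg_mem w.2
        rw [hu, map_zero, add_zero] at h
        simp only [Prod.mk_eq_zero]
        exact ⟨⟨Subtype.ext h, Subtype.ext hu⟩, Subtype.ext ht⟩
      · intro w
        have : w ∈ (W1 ⊔ LinearMap.range b) ⊔ T := hT.sup_eq_top ▸ Submodule.mem_top
        obtain ⟨x, hx, t, ht, rfl⟩ := Submodule.mem_sup.1 this
        obtain ⟨y, hy, z, ⟨v, rfl⟩, rfl⟩ := Submodule.mem_sup.1 hx
        have : v ∈ W1.comap b ⊔ U := hU.sup_eq_top ▸ Submodule.mem_top
        obtain ⟨v1, hv1, u, hu, rfl⟩ := Submodule.mem_sup.1 this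
        refine ⟨((⟨y, hy⟩ + ⟨b v1, hv1⟩, ⟨u, hu⟩), ⟨t, ht⟩), ?_⟩
        rw [hF]
        simp [add_assoc]
    refine ⟨LinearEquiv.trans
      ⟨LinearMap.fst ℂ ((W1.comap b) × U) PUnit, fun v => (v, 0), fun v => rfl, fun v => rfl⟩ e0,
      LinearEquiv.ofBijective F hFb, ?_, ?_⟩
    · rintro ⟨⟨v, u⟩, t⟩
      change F ((a1 v + s u, 0), 0) = a (e0 (v, u))
      rw [hF, he0]
      simp [a1, s]
    · rintro ⟨⟨v, u⟩, t⟩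
      change F ((b1 v, u), 0) = b (e0 (v, u))
      rw [hF, he0]
      simp
      rfl

/-- A pair all of whose extensions are under control. -/
def ExtOK (𝒞 : MatrixPair → Prop) (a b : V →ₗ[ℂ] W) : Prop :=
  ∃ (C : Type) (_ : AddCommGroup C) (_ : Module ℂ C) (s0 : C →ₗ[ℂ] W) (π : W →ₗ[ℂ] C),
    (∀ c, π (s0 c) = c) ∧ (∀ w, π w = 0 ↔ w ∈ LinearMap.range a) ∧
    Dec 𝒞 (extA a s0) (extB C b)

theorem ExtOK.of_iso {a b : V →ₗ[ℂ] W} {a' b' : V' →ₗ[ℂ] W'} (h : ExtOK 𝒞 a' b')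
    (h' : KIso a b a' b') : ExtOK 𝒞 a b := by
  obtain ⟨C, _, _, s0, π, h1, h2, h3⟩ := h
  obtain ⟨e, f, he, hf⟩ := h'
  refine ⟨C, _, _, f.symm.toLinearMap ∘ₗ s0, π ∘ₗ f.toLinearMap, fun c => by simp [h1],
    fun w => ?_, h3.of_iso ?_⟩
  · change π (f w) = 0 ↔ _
    rw [h2]
    constructor
    · rintro ⟨v, hv⟩
      refine ⟨e.symm v, f.injective ?_⟩
      rw [he, LinearEquiv.apply_symm_apply, hv]
    · rintro ⟨v, rfl⟩
      exact ⟨e v, (he v).symm⟩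
  · refine ⟨e.prodCongr (LinearEquiv.refl ℂ C), f.prodCongr (LinearEquiv.refl ℂ C), ?_, ?_⟩
    · rintro ⟨v, c⟩
      simp [he]
    · rintro ⟨v, c⟩
      simp [hf]

theorem ExtOK.prod {a b : V →ₗ[ℂ] W} {a' b' : V' →ₗ[ℂ] W'} (h : ExtOK 𝒞 a b)
    (h' : ExtOK 𝒞 a' b') : ExtOK 𝒞 (a.prodMap a') (b.prodMap b') := by
  obtain ⟨C, _, _, s0, π, h1, h2, h3⟩ := h
  obtain ⟨C', _, _, s0', π', h1', h2', h3'⟩ := h'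
  refine ⟨C × C', inferInstance, inferInstance, s0.prodMap s0', π.prodMap π',
    fun c => by simp [h1, h1'], fun w => ?_, (h3.prod h3').of_iso ?_⟩
  · simp [LinearMap.range_prodMap, h2, h2']
  · refine ⟨LinearEquiv.prodProdProdComm ℂ _ _ _ _, LinearEquiv.prodProdProdComm ℂ _ _ _ _, ?_, ?_⟩
    · rintro ⟨⟨v, v'⟩, ⟨c, c'⟩⟩
      simp
    · rintro ⟨⟨v, v'⟩, ⟨c, c'⟩⟩
      simp

theorem ExtOK.of_surj {a b : V →ₗ[ℂ] W} (ha : Function.Surjective a) (h : Dec 𝒞 a b) :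
    ExtOK 𝒞 a b := by
  refine ⟨PUnit, inferInstance, inferInstance, 0, 0, fun c => rfl, fun w => ?_, h.of_iso ?_⟩
  · simp [LinearMap.range_eq_top.2 ha]
  · refine KIso.trans ?_ (KIso_prod_subsing a b (0 : PUnit →ₗ[ℂ] PUnit) LinearMap.id)
    refine ⟨LinearEquiv.refl _ _, LinearEquiv.refl _ _, ?_, ?_⟩
    · rintro ⟨v, c⟩
      simp
    · rintro ⟨v, c⟩
      simp

theorem Dec.extOK {a b : V →ₗ[ℂ] W} (h : Dec 𝒞 a b)
    (h𝒞 : ∀ P, 𝒞 P → ExtOK 𝒞 (lA P) (lB P)) : ExtOK 𝒞 a b := by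
  obtain ⟨L, hL, h⟩ := h
  refine ExtOK.of_iso ?_ h
  refine Dec.induct (𝒞 := 𝒞) (fun P => ExtOK 𝒞 (lA P) (lB P)) ?_ ?_ L hL
  · have : Subsingleton (Fin MatrixPair.zero.p → ℂ) := inferInstanceAs (Subsingleton (Fin 0 → ℂ))
    have : Subsingleton (Fin MatrixPair.zero.q → ℂ) := inferInstanceAs (Subsingleton (Fin 0 → ℂ))
    exact ExtOK.of_surj (fun w => ⟨0, Subsingleton.elim _ _⟩) (Dec.subsing _ _)
  · intro P P' hP hP'
    exact ((h𝒞 P hP).prod hP').of_iso (KIso_dsum _ _)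

theorem dec_id {P : MatrixPair} (hP : 𝒞 P) (hP' : P = ⟨1, 1, 0, 1⟩) (n : ℕ) :
    ∀ (K : Type) [AddCommGroup K] [Module ℂ K] [FiniteDimensional ℂ K], Module.finrank ℂ K = n →
    Dec 𝒞 (0 : K →ₗ[ℂ] K) LinearMap.id := by
  subst hP'
  induction n with
  | zero =>
    intro K _ _ _ h
    have := Module.finrank_zero_iff.1 h
    exact Dec.subsing _ _
  | succ n ih =>
    intro K _ _ _ h
    have e : K ≃ₗ[ℂ] (Fin 1 → ℂ) × (Fin n → ℂ) :=
      LinearEquiv.ofFinrankEq _ _ (by simp [h, add_comm])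
    refine ((Dec.single hP).prod (ih (Fin n → ℂ) (by simp))).of_iso ⟨e, e, ?_, ?_⟩
    · intro v
      simp
      rfl
    · intro v
      simp

theorem dec_zero {P : MatrixPair} (hP : 𝒞 P) (hP' : P = ⟨1, 0, 0, 0⟩) (n : ℕ) :
    ∀ (K : Type) [AddCommGroup K] [Module ℂ K] [FiniteDimensional ℂ K], Module.finrank ℂ K = n →
    Dec 𝒞 (0 : PUnit →ₗ[ℂ] K) 0 := by
  subst hP'
  induction n with
  | zero =>
    intro K _ _ _ h
    have := Module.finrank_zero_iff.1 h
    exact Dec.subsing _ _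
  | succ n ih =>
    intro K _ _ _ h
    have e : K ≃ₗ[ℂ] (Fin 1 → ℂ) × (Fin n → ℂ) :=
      LinearEquiv.ofFinrankEq _ _ (by simp [h, add_comm])
    have e' : PUnit ≃ₗ[ℂ] (Fin 0 → ℂ) × PUnit := LinearEquiv.ofSubsingleton _ _
    refine ((Dec.single hP).prod (ih (Fin n → ℂ) (by simp))).of_iso ⟨e', e, ?_, ?_⟩
    · intro v
      simp
      rfl
    · intro v
      simp
      rfl

/-- The deflation step. -/
theorem step [FiniteDimensional ℂ V] [FiniteDimensional ℂ W]
    (h𝒞 : ∀ P, 𝒞 P → ExtOK 𝒞 (lA P) (lB P)) (hS : 𝒞 ⟨1, 1, 0, 1⟩)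
    (a b : V →ₗ[ℂ] W) (hb : Function.Surjective b ∨ 𝒞 ⟨1, 0, 0, 0⟩)
    (ih : ∀ (a1 b1 : (LinearMap.range a).comap b →ₗ[ℂ] LinearMap.range a),
      (∀ v, (a1 v : W) = a v) → (∀ v, (b1 v : W) = b v) → Dec 𝒞 a1 b1) : Dec 𝒞 a b := by
  obtain ⟨U, T, s, a1, b1, h1, h2, h3, h4, h5⟩ := decompose a b
  refine Dec.of_iso (Dec.prod ?_ ?_) h5
  · obtain ⟨C, _, _, s0, π, k1, k2, k3⟩ := (ih a1 b1 h1 h2).extOK h𝒞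
    obtain ⟨K, hK⟩ := ext_change a1 b1 s0 π k1 k2 s h3
    exact (k3.prod (dec_id hS rfl _ K rfl)).of_iso hK
  · rcases hb with hb | hb
    · have := h4 hb
      exact Dec.subsing _ _
    · exact dec_zero hb rfl _ T rfl

end ext

section blocks

theorem isUnit_of_upper {n : ℕ} (M : Matrix (Fin n) (Fin n) ℂ) (h : ∀ i j, j < i → M i j = 0)
    (hd : ∀ i, M i i ≠ 0) : IsUnit M := by
  rw [Matrix.isUnit_iff_isUnit_det, Matrix.det_of_isUpperTriangular (fun i j hij => h i j hij),
    isUnit_iff_ne_zero]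
  exact Finset.prod_ne_zero_iff.2 fun i _ => hd i

theorem Jmat_isUnit (n : ℕ) {l : ℂ} (hl : l ≠ 0) : IsUnit (Jmat n l) := by
  refine isUnit_of_upper _ (fun i j hij => ?_) (fun i => ?_)
  · have : (j : ℕ) < i := hij
    simp only [Jmat, Matrix.of_apply]
    rw [if_neg (by omega), if_neg (by omega)]
  · simpa [Jmat] using hl

theorem Jmat_last (k : ℕ) (l : ℂ) (v : Fin (k + 1) → ℂ) :
    (Jmat (k + 1) l).mulVec v (Fin.last k) = l * v (Fin.last k) := by
  rw [Matrix.mulVec, dotProduct, Finset.sum_eq_single (Fin.last k)]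
  · simp [Jmat]
  · intro j _ hj
    have : (j : ℕ) ≠ k := fun h => hj (Fin.ext h)
    have := j.2
    simp only [Jmat, Matrix.of_apply, Fin.val_last]
    rw [if_neg (by omega), if_neg (by omega), zero_mul]
  · simp

theorem Jmat_castSucc (k : ℕ) (l : ℂ) (v : Fin (k + 1) → ℂ) (i : Fin k) :
    (Jmat (k + 1) l).mulVec v i.castSucc = l * v i.castSucc + v i.succ := by
  rw [Matrix.mulVec, dotProduct,
    Finset.sum_eq_add (i.castSucc) (i.succ) (Fin.castSucc_lt_succ).ne]
  · simp [Jmat]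
  · intro j _ hj
    have h1 : (j : ℕ) ≠ i := fun h => hj.1 (Fin.ext h)
    have h2 : (j : ℕ) ≠ i + 1 := fun h => hj.2 (Fin.ext h)
    simp only [Jmat, Matrix.of_apply, Fin.val_castSucc]
    rw [if_neg (by omega), if_neg (by omega), zero_mul]
  · simp
  · simp

theorem Jmat_zero_mulVec (k : ℕ) (v : Fin (k + 1) → ℂ) :
    (Jmat (k + 1) 0).mulVec v = Fin.snoc (α := fun _ => ℂ) (fun i : Fin k => v i.succ) 0 := by
  ext i
  refine Fin.lastCases ?_ (fun i => ?_) i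
  · rw [Jmat_last]; simp
  · rw [Jmat_castSucc]; simp

theorem Fmat_mulVec (k : ℕ) (v : Fin (k + 1) → ℂ) (i : Fin k) :
    (Fmat (k + 1)).mulVec v i = v i.castSucc := by
  rw [Matrix.mulVec, dotProduct, Finset.sum_eq_single i.castSucc]
  · simp [Fmat]
  · intro j _ hj
    have h1 : (j : ℕ) ≠ i := fun h => hj (Fin.ext h)
    simp [Fmat, h1]
  · simp

theorem Gmat_mulVec (k : ℕ) (v : Fin (k + 1) → ℂ) (i : Fin k) :
    (Gmat (k + 1)).mulVec v i = v i.succ := by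
  rw [Matrix.mulVec, dotProduct, Finset.sum_eq_single i.succ]
  · simp [Gmat]
  · intro j _ hj
    have h1 : (j : ℕ) ≠ i + 1 := fun h => hj (Fin.ext h)
    simp [Gmat, h1]
  · simp

theorem FmatT_mulVec (k : ℕ) (v : Fin k → ℂ) :
    (Fmat (k + 1))ᵀ.mulVec v = Fin.snoc (α := fun _ => ℂ) v 0 := by
  ext i
  refine Fin.lastCases ?_ (fun i => ?_) i
  · rw [Fin.snoc_last, Matrix.mulVec, dotProduct]
    refine Finset.sum_eq_zero fun j _ => ?_
    have := j.2
    simp only [Fmat, Matrix.transpose_apply, Matrix.of_apply, Fin.val_last]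
    rw [if_neg (by omega), zero_mul]
  · rw [Fin.snoc_castSucc, Matrix.mulVec, dotProduct]
    refine (Finset.sum_eq_single (i : Fin (k + 1 - 1)) ?_ ?_).trans ?_
    · intro j _ hj
      have h1 : (i : ℕ) ≠ j := fun h => hj (Fin.ext h.symm)
      simp [Fmat, h1]
    · simp
    · simp [Fmat]

theorem GmatT_mulVec (k : ℕ) (v : Fin k → ℂ) :
    (Gmat (k + 1))ᵀ.mulVec v = Fin.cons (α := fun _ => ℂ) 0 v := by
  ext i
  refine Fin.cases ?_ (fun i => ?_) i
  · rw [Fin.cons_zero, Matrix.mulVec, dotProduct]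
    refine Finset.sum_eq_zero fun j _ => ?_
    simp [Gmat]
  · rw [Fin.cons_succ, Matrix.mulVec, dotProduct]
    refine (Finset.sum_eq_single (i : Fin (k + 1 - 1)) ?_ ?_).trans ?_
    · intro j _ hj
      have h1 : (i : ℕ) ≠ j := fun h => hj (Fin.ext h.symm)
      simp [Gmat, h1]
    · simp
    · simp [Gmat]

/-- `(v, c) ↦ snoc v c` -/
noncomputable def snocE (k : ℕ) : ((Fin k → ℂ) × ℂ) ≃ₗ[ℂ] (Fin (k + 1) → ℂ) where
  toFun x := Fin.snoc (α := fun _ => ℂ) x.1 x.2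
  invFun w := (fun i => w i.castSucc, w (Fin.last k))
  map_add' x y := by
    ext i
    refine Fin.lastCases ?_ (fun i => ?_) i <;> simp
  map_smul' c x := by
    ext i
    refine Fin.lastCases ?_ (fun i => ?_) i <;> simp
  left_inv x := by simp
  right_inv w := by
    ext i
    refine Fin.lastCases ?_ (fun i => ?_) i <;> simp

theorem snocE_apply (k : ℕ) (v : Fin k → ℂ) (c : ℂ) :
    snocE k (v, c) = Fin.snoc (α := fun _ => ℂ) v c := rfl

/-- `c ↦ c e_last` -/
noncomputable def lastIn (k : ℕ) : ℂ →ₗ[ℂ] (Fin (k + 1) → ℂ) :=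
  (snocE k).toLinearMap ∘ₗ LinearMap.inr ℂ _ ℂ

theorem lastIn_apply (k : ℕ) (c : ℂ) :
    lastIn k c = Fin.snoc (α := fun _ => ℂ) (0 : Fin k → ℂ) c := rfl

theorem snoc_add_lastIn (k : ℕ) (v : Fin k → ℂ) (c : ℂ) :
    (Fin.snoc (α := fun _ => ℂ) v 0 : Fin (k + 1) → ℂ) + lastIn k c =
      Fin.snoc (α := fun _ => ℂ) v c := by
  rw [lastIn_apply]
  ext i
  refine Fin.lastCases ?_ (fun i => ?_) i <;> simp

variable {𝒞 : MatrixPair → Prop}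

theorem extOK_S (k : ℕ) (h : 𝒞 ⟨k + 2, k + 2, Jmat (k + 2) 0, 1⟩) :
    ExtOK 𝒞 (Jmat (k + 1) 0).mulVecLin (1 : Matrix (Fin (k + 1)) (Fin (k + 1)) ℂ).mulVecLin := by
  refine ⟨ℂ, inferInstance, inferInstance, lastIn k, LinearMap.proj (Fin.last k), ?_, ?_, ?_⟩
  · intro c
    simp [lastIn_apply]
  · intro w
    constructor
    · intro hw
      refine ⟨Fin.cons (α := fun _ => ℂ) 0 (fun i : Fin k => w i.castSucc), ?_⟩
      rw [Matrix.mulVecLin_apply, Jmat_zero_mulVec]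
      ext i
      refine Fin.lastCases ?_ (fun i => ?_) i
      · simpa using hw.symm
      · simp
    · rintro ⟨v, rfl⟩
      simp [Jmat_zero_mulVec]
  · refine (Dec.single h).of_iso ⟨snocE (k + 1), snocE (k + 1), ?_, ?_⟩
    · rintro ⟨v, c⟩
      change snocE (k + 1) (extA _ _ (v, c)) = (Jmat (k + 2) 0).mulVec (snocE (k + 1) (v, c))
      rw [extA_apply, Matrix.mulVecLin_apply, Jmat_zero_mulVec, Jmat_zero_mulVec, snoc_add_lastIn,
        snocE_apply, snocE_apply]
      congr 1
      ext i
      refine Fin.lastCases ?_ (fun i => ?_) i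
      · simp
      · simp only [Fin.snoc_castSucc, Fin.succ_castSucc]
    · rintro ⟨v, c⟩
      change snocE (k + 1) (extB _ _ (v, c)) =
        (1 : Matrix (Fin (k + 2)) (Fin (k + 2)) ℂ).mulVec (snocE (k + 1) (v, c))
      rw [extB_apply, Matrix.mulVecLin_apply, Matrix.one_mulVec, Matrix.one_mulVec]

theorem extOK_P (k : ℕ) (h : 𝒞 ⟨k + 2, k + 2 - 1, (Fmat (k + 2))ᵀ, (Gmat (k + 2))ᵀ⟩) :
    ExtOK 𝒞 (Fmat (k + 1))ᵀ.mulVecLin (Gmat (k + 1))ᵀ.mulVecLin := by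
  refine ⟨ℂ, inferInstance, inferInstance, lastIn k, LinearMap.proj (Fin.last k), ?_, ?_, ?_⟩
  · intro c
    simp [lastIn_apply]
  · intro w
    constructor
    · intro hw
      refine ⟨(fun i : Fin k => w i.castSucc), ?_⟩
      rw [Matrix.mulVecLin_apply]
      refine (FmatT_mulVec k _).trans ?_
      ext i
      refine Fin.lastCases ?_ (fun i => ?_) i
      · simpa using hw.symm
      · simp
    · rintro ⟨v, rfl⟩
      have := FmatT_mulVec k v
      rw [Matrix.mulVecLin_apply]
      refine (congrFun this _).trans ?_
      simp
  · refine (Dec.single h).of_iso ⟨snocE k, snocE (k + 1), ?_, ?_⟩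
    · rintro ⟨v, c⟩
      change snocE (k + 1) (extA _ _ (v, c)) = (Fmat (k + 2))ᵀ.mulVec (snocE k (v, c))
      rw [extA_apply, Matrix.mulVecLin_apply]
      refine Eq.trans ?_ (FmatT_mulVec (k + 1) _).symm
      have := FmatT_mulVec k v
      change snocE (k + 1) ((Fmat (k + 1))ᵀ.mulVec v + _, _) = _
      rw [this, snoc_add_lastIn, snocE_apply, snocE_apply]
    · rintro ⟨v, c⟩
      change snocE (k + 1) (extB _ _ (v, c)) = (Gmat (k + 2))ᵀ.mulVec (snocE k (v, c))
      rw [extB_apply, Matrix.mulVecLin_apply]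
      refine Eq.trans ?_ (GmatT_mulVec (k + 1) _).symm
      have := GmatT_mulVec k v
      change snocE (k + 1) ((Gmat (k + 1))ᵀ.mulVec v, _) = _
      rw [this, snocE_apply, snocE_apply, Fin.cons_snoc_eq_snoc_cons]

/-- The class of Jordan pairs. -/
def CJ (P : MatrixPair) : Prop := ∃ n : ℕ, 1 ≤ n ∧ ∃ l : ℂ, P = ⟨n, n, Jmat n l, 1⟩

theorem mulVecLin_surj {n : ℕ} {M : Matrix (Fin n) (Fin n) ℂ} (h : IsUnit M) :
    Function.Surjective M.mulVecLin := Matrix.mulVec_surjective_iff_isUnit.2 h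

theorem mulVecLin_inj {n : ℕ} {M : Matrix (Fin n) (Fin n) ℂ} (h : IsUnit M) :
    Function.Injective M.mulVecLin := Matrix.mulVec_injective_iff_isUnit.2 h

theorem CJ_ext (P : MatrixPair) (hP : CJ P) : ExtOK CJ (lA P) (lB P) := by
  have hP0 := hP
  obtain ⟨n, hn, l, rfl⟩ := hP
  obtain ⟨k, rfl⟩ : ∃ k, n = k + 1 := ⟨n - 1, by omega⟩
  by_cases hl : l = 0
  · subst hl
    exact extOK_S k ⟨k + 2, by omega, 0, rfl⟩
  · exact ExtOK.of_surj (mulVecLin_surj (Jmat_isUnit _ hl)) (Dec.single hP0)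

theorem pair_S1 : (⟨1, 1, 0, 1⟩ : MatrixPair) = ⟨1, 1, Jmat 1 0, 1⟩ := by
  have : Jmat 1 0 = 0 := by
    ext i j
    have : i = 0 := Subsingleton.elim _ _
    have : j = 0 := Subsingleton.elim _ _
    subst_vars
    simp [Jmat]
  rw [this]

theorem KC_ext (P : MatrixPair) (hP : KroneckerCanonical P) :
    ExtOK KroneckerCanonical (lA P) (lB P) := by
  have hP0 := hP
  obtain ⟨n, hn, hP⟩ := hP
  obtain ⟨k, rfl⟩ : ∃ k, n = k + 1 := ⟨n - 1, by omega⟩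
  rcases hP with ⟨l, rfl⟩ | rfl | rfl | rfl
  · exact ExtOK.of_surj (mulVecLin_surj isUnit_one) (Dec.single hP0)
  · exact extOK_S k ⟨k + 2, by omega, Or.inr (Or.inl rfl)⟩
  · refine ExtOK.of_surj ?_ (Dec.single hP0)
    intro w
    refine ⟨Fin.snoc (α := fun _ => ℂ) (w : Fin k → ℂ) 0, ?_⟩
    ext i
    refine (Fmat_mulVec k _ i).trans ?_
    rw [Fin.snoc_castSucc]
  · exact extOK_P k ⟨k + 2, by omega, Or.inr (Or.inr (Or.inr rfl))⟩

theorem subst_shift (n : ℕ) (l μ : ℂ) :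
    subst 1 μ 0 1 ⟨n, n, Jmat n l, 1⟩ = ⟨n, n, Jmat n (l + μ), 1⟩ := by
  refine congrArg₂ (MatrixPair.mk n n) ?_ ?_
  · ext i j
    by_cases h : i = j
    · subst h
      simp [Jmat]
    · have h' : (j : ℕ) ≠ i := fun h' => h (Fin.ext h'.symm)
      simp [Jmat, h', h]
  · simp

theorem subst_swap (n : ℕ) (l : ℂ) :
    subst 0 1 1 0 ⟨n, n, Jmat n l, 1⟩ = ⟨n, n, 1, Jmat n l⟩ := by
  refine congrArg₂ (MatrixPair.mk n n) ?_ ?_ <;> simp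

theorem jordan (n : ℕ) : ∀ (V W : Type) [AddCommGroup V] [Module ℂ V] [AddCommGroup W] [Module ℂ W]
    [FiniteDimensional ℂ V] [FiniteDimensional ℂ W] (a b : V →ₗ[ℂ] W),
    Function.Bijective b → Module.finrank ℂ W = n → Dec CJ a b := by
  induction n using Nat.strong_induction_on with
  | _ n ih =>
  intro V W _ _ _ _ _ _ a b hb hn
  let be := LinearEquiv.ofBijective b hb
  have hfr : Module.finrank ℂ V = Module.finrank ℂ W := be.finrank_eq
  rcases Nat.eq_zero_or_pos n with h0 | h0
  · have := Module.finrank_zero_iff.1 (hn.trans h0)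
    have := Module.finrank_zero_iff.1 (hfr.trans (hn.trans h0))
    exact Dec.subsing _ _
  have : Nontrivial V := Module.nontrivial_of_finrank_pos (R := ℂ) (by omega)
  obtain ⟨μ, hμ⟩ := Module.End.exists_eigenvalue (be.symm.toLinearMap ∘ₗ a)
  obtain ⟨v, hv⟩ := hμ.exists_hasEigenvector
  have hav : a v = μ • b v := by
    have := hv.apply_eq_smul
    simp only [LinearMap.comp_apply, LinearEquiv.coe_coe, LinearEquiv.symm_apply_eq, map_smul] at this
    exact this
  have hv0 := hv.2
  have key : Dec CJ (a - μ • b) b := by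
    refine step CJ_ext ⟨1, le_rfl, 0, pair_S1⟩ _ _ (Or.inl hb.2) ?_
    intro a1 b1 h1 h2
    refine ih (Module.finrank ℂ (LinearMap.range (a - μ • b))) ?_ _ _ a1 b1 ⟨?_, ?_⟩ rfl
    · rw [← hn]
      refine Submodule.finrank_lt (fun htop => hv0 ?_)
      have hs := LinearMap.range_eq_top.1 htop
      have hi := (LinearMap.injective_iff_surjective_of_finrank_eq_finrank hfr).2 hs
      apply hi
      simp [hav]
    · intro x y hxy
      apply Subtype.ext
      apply hb.1
      rw [← h2, ← h2, hxy]
    · rintro ⟨w, hw⟩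
      obtain ⟨v, rfl⟩ := hb.2 w
      exact ⟨⟨v, hw⟩, Subtype.ext (h2 _)⟩
  have := key.subst (𝒞' := CJ) 1 μ 0 1 (by
    rintro P ⟨n, hn, l, rfl⟩
    rw [subst_shift]
    exact Dec.single ⟨n, hn, _, rfl⟩)
  simpa using this

theorem Jmat_transpose (n : ℕ) (l : ℂ) :
    (Jmat n l)ᵀ = (Jmat n l).submatrix Fin.revPerm Fin.revPerm := by
  ext i j
  simp only [Jmat, Matrix.transpose_apply, Matrix.of_apply, Matrix.submatrix_apply,
    Fin.revPerm_apply, Fin.val_rev]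
  have := i.2
  have := j.2
  congr 1
  · simp only [eq_iff_iff]; omega
  · congr 1
    simp only [eq_iff_iff]; omega

theorem Jmat_rev (n : ℕ) (l : ℂ) (v : Fin n → ℂ) :
    LinearEquiv.funCongrLeft ℂ ℂ Fin.revPerm ((Jmat n l)ᵀ.mulVec v) =
      (Jmat n l).mulVec (LinearEquiv.funCongrLeft ℂ ℂ Fin.revPerm v) := by
  rw [Jmat_transpose, Matrix.submatrix_mulVec_equiv]
  ext i
  simp [LinearEquiv.funCongrLeft, LinearMap.funLeft]

theorem one_rev (n : ℕ) (v : Fin n → ℂ) :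
    LinearEquiv.funCongrLeft ℂ ℂ Fin.revPerm ((1 : Matrix (Fin n) (Fin n) ℂ)ᵀ.mulVec v) =
      (1 : Matrix (Fin n) (Fin n) ℂ).mulVec (LinearEquiv.funCongrLeft ℂ ℂ Fin.revPerm v) := by
  rw [Matrix.transpose_one, Matrix.one_mulVec, Matrix.one_mulVec]

theorem KC_tr (P : MatrixPair) (hP : KroneckerCanonical P) :
    Dec KroneckerCanonical (lA (tr P)) (lB (tr P)) := by
  have hP0 := hP
  obtain ⟨n, hn, hP⟩ := hP
  rcases hP with ⟨l, rfl⟩ | rfl | rfl | rfl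
  · refine (Dec.single hP0).of_iso ⟨LinearEquiv.funCongrLeft ℂ ℂ Fin.revPerm,
      LinearEquiv.funCongrLeft ℂ ℂ Fin.revPerm, fun v => ?_, fun v => ?_⟩
    · exact one_rev n v
    · exact Jmat_rev n l v
  · refine (Dec.single hP0).of_iso ⟨LinearEquiv.funCongrLeft ℂ ℂ Fin.revPerm,
      LinearEquiv.funCongrLeft ℂ ℂ Fin.revPerm, fun v => ?_, fun v => ?_⟩
    · exact Jmat_rev n 0 v
    · exact one_rev n v
  · exact Dec.single ⟨n, hn, Or.inr (Or.inr (Or.inr rfl))⟩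
  · exact Dec.single ⟨n, hn, Or.inr (Or.inr (Or.inl rfl))⟩

theorem pair_P1 : KroneckerCanonical ⟨1, 0, 0, 0⟩ := by
  refine ⟨1, le_rfl, Or.inr (Or.inr (Or.inr ?_))⟩
  refine congrArg₂ (MatrixPair.mk 1 0) ?_ ?_ <;>
  · ext i j
    exact j.elim0

theorem exists_dec (N : ℕ) : ∀ P : MatrixPair, P.p + P.q = N →
    Dec KroneckerCanonical (lA P) (lB P) := by
  induction N using Nat.strong_induction_on with
  | _ N ih =>
  have key : ∀ P : MatrixPair, P.p + P.q = N → ¬ Function.Surjective (lA P) →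
      Dec KroneckerCanonical (lA P) (lB P) := by
    intro P hP hs
    refine step KC_ext ⟨1, le_rfl, Or.inr (Or.inl pair_S1)⟩ _ _ (Or.inr pair_P1) ?_
    intro a1 b1 _ _
    obtain ⟨Q, h1, h2, h3⟩ := exists_pair a1 b1
    refine (ih _ ?_ Q rfl).of_iso h3
    rw [h1, h2]
    have e1 : Module.finrank ℂ (LinearMap.range (lA P)) < P.p := by
      have := Submodule.finrank_lt (fun h => hs (LinearMap.range_eq_top.1 h))
      simpa using this
    have e2 : Module.finrank ℂ ((LinearMap.range (lA P)).comap (lB P)) ≤ P.q := by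
      simpa using Submodule.finrank_le ((LinearMap.range (lA P)).comap (lB P))
    omega
  intro P hP
  by_cases hs : Function.Surjective (lA P)
  · by_cases hi : Function.Injective (lA P)
    · have := (jordan _ _ _ (lB P) (lA P) ⟨hi, hs⟩ rfl).subst (𝒞' := KroneckerCanonical) 0 1 1 0 (by
        rintro P ⟨n, hn, l, rfl⟩
        rw [subst_swap]
        exact Dec.single ⟨n, hn, Or.inl ⟨_, rfl⟩⟩)
      simpa using this
    · have h1 := key (tr P) (by rw [← hP, add_comm]; rfl) (by
        intro hs'
        have hr : P.Aᵀ.rank = P.q := by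
          rw [Matrix.rank]
          have : LinearMap.range P.Aᵀ.mulVecLin = ⊤ := LinearMap.range_eq_top.2 hs'
          rw [this]; simp
        rw [Matrix.rank_transpose] at hr
        apply hi
        rw [← LinearMap.ker_eq_bot]
        apply Submodule.finrank_eq_zero.1
        have := LinearMap.finrank_range_add_finrank_ker (lA P)
        change Module.finrank ℂ (LinearMap.range (lA P)) = _ at hr
        simp only [Module.finrank_fintype_fun_eq_card, Fintype.card_fin] at this
        omega)
      exact h1.tr KC_tr
  · exact key P hP hs

end blocks

section uniq

variable {V W V' W' : Type}
  [AddCommGroup V] [Module ℂ V] [AddCommGroup W] [Module ℂ W]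
  [AddCommGroup V'] [Module ℂ V'] [AddCommGroup W'] [Module ℂ W']

/-- The chain of subspaces `K₀ = 0`, `K_{m+1} = a⁻¹(b(K_m))`. -/
noncomputable def KK (a b : V →ₗ[ℂ] W) : ℕ → Submodule ℂ V
  | 0 => ⊥
  | m + 1 => ((KK a b m).map b).comap a

theorem KK_iso {a b : V →ₗ[ℂ] W} {a' b' : V' →ₗ[ℂ] W'} (e : V ≃ₗ[ℂ] V') (f : W ≃ₗ[ℂ] W')
    (h1 : ∀ v, f (a v) = a' (e v)) (h2 : ∀ v, f (b v) = b' (e v)) (m : ℕ) (v : V) :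
    e v ∈ KK a' b' m ↔ v ∈ KK a b m := by
  induction m generalizing v with
  | zero => simp [KK]
  | succ m ih =>
    simp only [KK, Submodule.mem_comap, Submodule.mem_map]
    constructor
    · rintro ⟨u, hu, hu'⟩
      obtain ⟨u, rfl⟩ := e.surjective u
      refine ⟨u, (ih u).1 hu, f.injective ?_⟩
      rw [h2, hu', h1]
    · rintro ⟨u, hu, hu'⟩
      refine ⟨e u, (ih u).2 hu, ?_⟩
      rw [← h2, hu', h1]

theorem KK_prod (a b : V →ₗ[ℂ] W) (a' b' : V' →ₗ[ℂ] W') (m : ℕ) :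
    KK (a.prodMap a') (b.prodMap b') m = (KK a b m).prod (KK a' b' m) := by
  induction m with
  | zero => simp [KK]
  | succ m ih =>
    ext ⟨v, v'⟩
    simp only [KK, ih, Submodule.mem_comap, Submodule.mem_map, Submodule.mem_prod, Prod.exists,
      LinearMap.prodMap_apply, Prod.mk.injEq]
    constructor
    · rintro ⟨u, u', ⟨h1, h2⟩, h3, h4⟩
      exact ⟨⟨u, h1, h3⟩, ⟨u', h2, h4⟩⟩
    · rintro ⟨⟨u, h1, h3⟩, ⟨u', h2, h4⟩⟩
      exact ⟨u, u', ⟨h1, h2⟩, h3, h4⟩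

theorem KK_inj {a b : V →ₗ[ℂ] W} (ha : Function.Injective a) (m : ℕ) : KK a b m = ⊥ := by
  induction m with
  | zero => rfl
  | succ m ih =>
    rw [KK, ih, Submodule.map_bot]
    exact LinearMap.ker_eq_bot.2 ha

theorem finrank_sub_prod [FiniteDimensional ℂ V] [FiniteDimensional ℂ V'] (S : Submodule ℂ V)
    (S' : Submodule ℂ V') :
    Module.finrank ℂ (S.prod S') = Module.finrank ℂ S + Module.finrank ℂ S' := by
  let e : (S.prod S') ≃ₗ[ℂ] (S × S') :=
    { toFun := fun x => (⟨x.1.1, x.2.1⟩, ⟨x.1.2, x.2.2⟩)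
      map_add' := fun _ _ => rfl
      map_smul' := fun _ _ => rfl
      invFun := fun y => ⟨(y.1.1, y.2.1), y.1.2, y.2.2⟩
      left_inv := fun _ => rfl
      right_inv := fun _ => rfl }
  rw [e.finrank_eq, Module.finrank_prod]

theorem finrank_of_mem_iff (e : V ≃ₗ[ℂ] V') (S : Submodule ℂ V) (S' : Submodule ℂ V')
    (h : ∀ v, e v ∈ S' ↔ v ∈ S) : Module.finrank ℂ S = Module.finrank ℂ S' := by
  have : S.map e.toLinearMap = S' := by
    ext v'
    obtain ⟨v, rfl⟩ := e.surjective v'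
    rw [h]
    simp
  rw [← this]
  exact (LinearEquiv.finrank_map_eq e S).symm

/-- Additive invariants. -/
structure Additive (f : MatrixPair → ℕ) : Prop where
  zero : f MatrixPair.zero = 0
  dsum : ∀ P Q, f (P.dsum Q) = f P + f Q
  sim : ∀ P Q : MatrixPair, P.SimEquiv Q → f P = f Q

noncomputable def i1 (m : ℕ) (P : MatrixPair) : ℕ :=
  Module.finrank ℂ (KK (lA P) (lB P) m ⊓ LinearMap.ker (lB P) : Submodule ℂ (Fin P.q → ℂ))

noncomputable def i2 (m : ℕ) (P : MatrixPair) : ℕ :=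
  Module.finrank ℂ (KK (lA P) (lB P) m)

theorem i1_additive (m : ℕ) : Additive (i1 m) where
  zero := by
    have : Subsingleton (Fin MatrixPair.zero.q → ℂ) := inferInstanceAs (Subsingleton (Fin 0 → ℂ))
    exact Module.finrank_zero_of_subsingleton
  dsum P Q := by
    obtain ⟨e, f, h1, h2⟩ := KIso_dsum P Q
    unfold i1
    rw [← finrank_sub_prod]
    refine finrank_of_mem_iff e _ _ fun v => ?_
    have := KK_iso e f h1 h2 m v
    rw [KK_prod] at this
    simp only [Submodule.mem_inf, Submodule.mem_prod, ← this, LinearMap.mem_ker]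
    have hb : (lB (P.dsum Q)) v = 0 ↔ (lB P (e v).1 = 0 ∧ lB Q (e v).2 = 0) := by
      rw [← f.map_eq_zero_iff, h2]
      simp only [LinearMap.prodMap_apply, Prod.mk_eq_zero]
    rw [hb]
    tauto
  sim P Q h := by
    obtain ⟨e, f, h1, h2⟩ := (KIso_iff P Q).1 h
    refine finrank_of_mem_iff e _ _ fun v => ?_
    rw [Submodule.mem_inf, Submodule.mem_inf, KK_iso e f h1 h2 m v, LinearMap.mem_ker,
      LinearMap.mem_ker, ← h2, f.map_eq_zero_iff]

theorem i2_additive (m : ℕ) : Additive (i2 m) where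
  zero := by
    have : Subsingleton (Fin MatrixPair.zero.q → ℂ) := inferInstanceAs (Subsingleton (Fin 0 → ℂ))
    exact Module.finrank_zero_of_subsingleton
  dsum P Q := by
    obtain ⟨e, f, h1, h2⟩ := KIso_dsum P Q
    unfold i2
    rw [← finrank_sub_prod]
    refine finrank_of_mem_iff e _ _ fun v => ?_
    have := KK_iso e f h1 h2 m v
    rw [KK_prod] at this
    exact this
  sim P Q h := by
    obtain ⟨e, f, h1, h2⟩ := (KIso_iff P Q).1 h
    exact finrank_of_mem_iff e _ _ fun v => KK_iso e f h1 h2 m v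

theorem Additive.tr {f : MatrixPair → ℕ} (hf : Additive f) : Additive (fun P => f (tr P)) where
  zero := by rw [tr_zero, hf.zero]
  dsum P Q := by rw [tr_dsum, hf.dsum]
  sim P Q h := hf.sim _ _ (tr_sim h)

theorem Additive.subst {f : MatrixPair → ℕ} (hf : Additive f) (α β γ δ : ℂ) :
    Additive (fun P => f (subst α β γ δ P)) where
  zero := by rw [subst_zero, hf.zero]
  dsum P Q := by rw [subst_dsum, hf.dsum]
  sim P Q h := by
    obtain ⟨R, R', S, S', h1, h2, h3, h4, hA, hB⟩ := h
    refine hf.sim _ _ ⟨R, R', S, S', h1, h2, h3, h4, ?_, ?_⟩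
    · change α • Q.A + β • Q.B = R * (α • P.A + β • P.B) * S
      rw [hA, hB]
      simp [Matrix.mul_add, Matrix.add_mul]
    · change γ • Q.A + δ • Q.B = R * (γ • P.A + δ • P.B) * S
      rw [hA, hB]
      simp [Matrix.mul_add, Matrix.add_mul]

theorem Additive.sum {f : MatrixPair → ℕ} (hf : Additive f) (L : List MatrixPair) :
    f (MatrixPair.dsumList L) = ((L : Multiset MatrixPair).map f).sum := by
  induction L with
  | nil => exact hf.zero
  | cons P L ih =>
    change f (P.dsum (MatrixPair.dsumList L)) = _
    rw [hf.dsum, ih]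
    simp

theorem i1_of_injA (m : ℕ) (P : MatrixPair) (h : Function.Injective (lA P)) : i1 m P = 0 := by
  rw [i1, KK_inj h, bot_inf_eq, finrank_bot]

theorem i1_of_injB (m : ℕ) (P : MatrixPair) (h : Function.Injective (lB P)) : i1 m P = 0 := by
  rw [i1, LinearMap.ker_eq_bot.2 h, inf_bot_eq, finrank_bot]

theorem i2_of_injA (m : ℕ) (P : MatrixPair) (h : Function.Injective (lA P)) : i2 m P = 0 := by
  rw [i2, KK_inj h, finrank_bot]

theorem KK_I (k m : ℕ) (v : Fin (k + 1) → ℂ) :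
    v ∈ KK (Fmat (k + 1)).mulVecLin (Gmat (k + 1)).mulVecLin m ↔
      ∀ j : Fin (k + 1), (j : ℕ) + m < k + 1 → v j = 0 := by
  induction m generalizing v with
  | zero =>
    simp only [KK, Submodule.mem_bot]
    constructor
    · rintro rfl j _
      rfl
    · intro h
      ext j
      exact h j j.2
  | succ m ih =>
    simp only [KK, Submodule.mem_comap, Submodule.mem_map, ih]
    have hF : ∀ u i, (Fmat (k + 1)).mulVecLin u i = u i.castSucc := Fmat_mulVec k
    have hG : ∀ u i, (Gmat (k + 1)).mulVecLin u i = u i.succ := Gmat_mulVec k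
    constructor
    · rintro ⟨u, hu, huv⟩ j hj
      have hjk : (j : ℕ) < k := by omega
      have := congrFun huv ⟨j, hjk⟩
      rw [hF, hG] at this
      have e : (Fin.castSucc ⟨j, hjk⟩ : Fin (k + 1)) = j := rfl
      refine (congrArg v e).symm.trans (this.symm.trans (hu _ ?_))
      simp
      omega
    · intro h
      refine ⟨Fin.cons (α := fun _ => ℂ) 0 (fun i : Fin k => v i.castSucc), ?_, ?_⟩
      · intro j
        refine Fin.cases ?_ (fun j => ?_) j
        · intro _; rfl
        · intro hj
          rw [Fin.cons_succ]
          apply h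
          simp at hj ⊢
          omega
      · ext i
        rw [hF, hG]
        rfl

theorem i1_I (k m : ℕ) :
    i1 m ⟨k + 1 - 1, k + 1, Fmat (k + 1), Gmat (k + 1)⟩ = if k + 1 ≤ m then 1 else 0 := by
  have hG : ∀ u i, (Gmat (k + 1)).mulVecLin u i = u i.succ := Gmat_mulVec k
  change Module.finrank ℂ (KK (Fmat (k + 1)).mulVecLin (Gmat (k + 1)).mulVecLin m ⊓
    LinearMap.ker (Gmat (k + 1)).mulVecLin : Submodule ℂ (Fin (k + 1) → ℂ)) = _
  split_ifs with h
  · have : KK (Fmat (k + 1)).mulVecLin (Gmat (k + 1)).mulVecLin m = ⊤ := by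
      rw [eq_top_iff]
      intro v _
      rw [KK_I]
      intro j hj
      omega
    rw [this, top_inf_eq]
    have h1 := LinearMap.finrank_range_add_finrank_ker (Gmat (k + 1)).mulVecLin
    have h2 : LinearMap.range (Gmat (k + 1)).mulVecLin = ⊤ := by
      rw [LinearMap.range_eq_top]
      intro w
      refine ⟨Fin.cons (α := fun _ => ℂ) 0 (w : Fin k → ℂ), ?_⟩
      ext i
      rw [hG]
      exact Fin.cons_succ (α := fun _ => ℂ) 0 (w : Fin k → ℂ) i
    rw [h2] at h1
    simp only [finrank_top, Module.finrank_fintype_fun_eq_card, Fintype.card_fin] at h1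
    omega
  · rw [Submodule.finrank_eq_zero, eq_bot_iff]
    rintro v ⟨h1, h2⟩
    have h1' := (KK_I k m v).1 h1
    have h2' := LinearMap.mem_ker.1 h2
    rw [Submodule.mem_bot]
    ext j
    refine Fin.cases ?_ (fun j => ?_) j
    · apply h1'
      simp
      omega
    · have := congrFun h2' j
      rw [hG] at this
      exact this

theorem KK_S (k m : ℕ) (v : Fin (k + 1) → ℂ) :
    v ∈ KK (Jmat (k + 1) 0).mulVecLin (1 : Matrix (Fin (k + 1)) (Fin (k + 1)) ℂ).mulVecLin m ↔
      ∀ j : Fin (k + 1), m ≤ (j : ℕ) → v j = 0 := by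
  induction m generalizing v with
  | zero =>
    simp only [KK, Submodule.mem_bot]
    constructor
    · rintro rfl j _
      rfl
    · intro h
      ext j
      exact h j (Nat.zero_le _)
  | succ m ih =>
    rw [KK, Submodule.mem_comap, Matrix.mulVecLin_one, Submodule.map_id, ← Matrix.mulVecLin_one, ih,
      Matrix.mulVecLin_apply, Jmat_zero_mulVec]
    constructor
    · intro h j
      refine Fin.cases ?_ (fun j => ?_) j
      · intro h; simp at h
      · intro hj
        have := h j.castSucc (by simp at hj ⊢; omega)
        simpa using this
    · intro h j
      refine Fin.lastCases ?_ (fun j => ?_) j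
      · intro _; simp
      · intro hj
        rw [Fin.snoc_castSucc]
        apply h
        simp at hj ⊢
        omega

theorem i2_S (k m : ℕ) : i2 m ⟨k + 1, k + 1, Jmat (k + 1) 0, 1⟩ = min m (k + 1) := by
  change Module.finrank ℂ (KK (Jmat (k + 1) 0).mulVecLin
    (1 : Matrix (Fin (k + 1)) (Fin (k + 1)) ℂ).mulVecLin m) = _
  let ρ : (Fin (k + 1) → ℂ) →ₗ[ℂ] ({j : Fin (k + 1) // m ≤ (j : ℕ)} → ℂ) :=
    LinearMap.funLeft ℂ ℂ Subtype.val
  have h1 := LinearMap.finrank_range_add_finrank_ker ρ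
  have h2 : LinearMap.range ρ = ⊤ :=
    LinearMap.range_eq_top.2 (LinearMap.funLeft_surjective_of_injective _ _ _
      Subtype.val_injective)
  have h3 : KK (Jmat (k + 1) 0).mulVecLin
      (1 : Matrix (Fin (k + 1)) (Fin (k + 1)) ℂ).mulVecLin m = LinearMap.ker ρ := by
    ext v
    rw [KK_S, LinearMap.mem_ker]
    constructor
    · intro h
      ext ⟨j, hj⟩
      exact h j hj
    · intro h j hj
      exact congrFun h ⟨j, hj⟩
  have h4 : Fintype.card {j : Fin (k + 1) // m ≤ (j : ℕ)} = k + 1 - m := by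
    let E : {j : Fin (k + 1) // m ≤ (j : ℕ)} ≃ Fin (k + 1 - m) :=
      { toFun := fun j => ⟨j.1 - m, by have := j.1.2; have := j.2; omega⟩
        invFun := fun i => ⟨⟨i + m, by omega⟩, by simp⟩
        left_inv := fun j => by
          have := j.2
          apply Subtype.ext; apply Fin.ext; simp; omega
        right_inv := fun i => by simp }
    simpa using Fintype.card_congr E
  rw [h3]
  rw [h2, finrank_top, Module.finrank_fintype_fun_eq_card, Module.finrank_fintype_fun_eq_card, h4,
    Fintype.card_fin] at h1
  omega

theorem FT_inj (k : ℕ) : Function.Injective (Fmat (k + 1))ᵀ.mulVecLin := by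
  intro v w h
  have h' : (Fmat (k + 1))ᵀ.mulVec v = (Fmat (k + 1))ᵀ.mulVec w := h
  have h2 := (FmatT_mulVec k v).symm.trans (h'.trans (FmatT_mulVec k w))
  ext i
  have := congrFun h2 (Fin.castSucc i)
  rw [Fin.snoc_castSucc, Fin.snoc_castSucc] at this
  exact this

theorem pencilT_inj (k : ℕ) (l : ℂ) :
    Function.Injective (-l • (Fmat (k + 1))ᵀ + (1 : ℂ) • (Gmat (k + 1))ᵀ).mulVecLin := by
  have hu : IsUnit ((-l • (Fmat (k + 1))ᵀ + (1 : ℂ) • (Gmat (k + 1))ᵀ).submatrix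
      (Fin.succ : Fin k → Fin (k + 1)) (id : Fin k → Fin k)) := by
    refine isUnit_of_upper _ (fun i j hij => ?_) (fun i => ?_)
    · have : (j : ℕ) < i := hij
      simp [Fmat, Gmat]
      rw [if_neg (by omega), if_neg (by omega)]
      simp
    · simp [Fmat, Gmat]
  intro v w h
  apply mulVecLin_inj hu
  ext i
  exact congrFun h i.succ

theorem pencilS_inj (n : ℕ) (l : ℂ) :
    Function.Injective (-l • Jmat n 0 + (1 : ℂ) • (1 : Matrix (Fin n) (Fin n) ℂ)).mulVecLin := by
  refine mulVecLin_inj (isUnit_of_upper _ (fun i j hij => ?_) (fun i => ?_))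
  · have : (j : ℕ) < i := hij
    have h2 : i ≠ j := ne_of_gt hij
    simp [Jmat, h2]
    intro _ _
    omega
  · simp [Jmat]

theorem subst_R (n : ℕ) (l μ : ℂ) :
    subst (-l) 1 1 0 ⟨n, n, 1, Jmat n μ⟩ = ⟨n, n, Jmat n (μ - l), 1⟩ := by
  refine congrArg₂ (MatrixPair.mk n n) ?_ ?_
  · ext i j
    by_cases h : i = j
    · subst h
      simp [Jmat]
      ring
    · have h' : (j : ℕ) ≠ i := fun h' => h (Fin.ext h'.symm)
      simp [Jmat, h', h]
  · simp

open Classical in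
theorem count_eq (N N' : Multiset MatrixPair) (X : MatrixPair) (f h : MatrixPair → ℕ)
    (hN : ∀ P ∈ N, f P = h P + if P = X then 1 else 0)
    (hN' : ∀ P ∈ N', f P = h P + if P = X then 1 else 0)
    (hf : (N.map f).sum = (N'.map f).sum) (hh : (N.map h).sum = (N'.map h).sum) :
    N.count X = N'.count X := by
  have key : ∀ N : Multiset MatrixPair, (∀ P ∈ N, f P = h P + if P = X then 1 else 0) →
      (N.map f).sum = (N.map h).sum + N.count X := by
    intro N
    induction N using Multiset.induction_on with
    | empty => simp
    | cons P N ih =>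
      intro hP
      rw [Multiset.map_cons, Multiset.sum_cons, Multiset.map_cons, Multiset.sum_cons,
        Multiset.count_cons, ih fun Q hQ => hP Q (Multiset.mem_cons_of_mem hQ),
        hP P (Multiset.mem_cons_self _ _)]
      by_cases hx : P = X
      · subst hx; simp; omega
      · simp [hx, Ne.symm hx]; omega
  have := key N hN
  have := key N' hN'
  omega

open Classical in
theorem i1_step (k : ℕ) (P : MatrixPair) (hP : KroneckerCanonical P) :
    i1 (k + 1) P = i1 k P +
      if P = ⟨k + 1 - 1, k + 1, Fmat (k + 1), Gmat (k + 1)⟩ then 1 else 0 := by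
  by_cases h : P = ⟨k + 1 - 1, k + 1, Fmat (k + 1), Gmat (k + 1)⟩
  · rw [if_pos h, h, i1_I, i1_I]
    simp
  rw [if_neg h]
  obtain ⟨n, hn, hP⟩ := hP
  obtain ⟨j, rfl⟩ : ∃ k, n = k + 1 := ⟨n - 1, by omega⟩
  rcases hP with ⟨l, rfl⟩ | rfl | rfl | rfl
  · rw [i1_of_injA, i1_of_injA] <;> exact mulVecLin_inj isUnit_one
  · rw [i1_of_injB, i1_of_injB] <;> exact mulVecLin_inj isUnit_one
  · rw [i1_I, i1_I]
    have : j ≠ k := by rintro rfl; exact h rfl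
    split_ifs <;> omega
  · rw [i1_of_injA, i1_of_injA] <;> exact FT_inj j

open Classical in
theorem i1_tr_step (k : ℕ) (P : MatrixPair) (hP : KroneckerCanonical P) :
    i1 (k + 1) (tr P) = i1 k (tr P) +
      if P = ⟨k + 1, k + 1 - 1, (Fmat (k + 1))ᵀ, (Gmat (k + 1))ᵀ⟩ then 1 else 0 := by
  have e : ∀ j, tr ⟨j + 1, j + 1 - 1, (Fmat (j + 1))ᵀ, (Gmat (j + 1))ᵀ⟩ =
    ⟨j + 1 - 1, j + 1, Fmat (j + 1), Gmat (j + 1)⟩ := fun j => rfl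
  by_cases h : P = ⟨k + 1, k + 1 - 1, (Fmat (k + 1))ᵀ, (Gmat (k + 1))ᵀ⟩
  · rw [if_pos h, h, e, i1_I, i1_I]
    simp
  rw [if_neg h]
  obtain ⟨n, hn, hP⟩ := hP
  obtain ⟨j, rfl⟩ : ∃ k, n = k + 1 := ⟨n - 1, by omega⟩
  have hu : IsUnit (1 : Matrix (Fin (j + 1)) (Fin (j + 1)) ℂ)ᵀ := by
    rw [Matrix.transpose_one]; exact isUnit_one
  rcases hP with ⟨l, rfl⟩ | rfl | rfl | rfl
  · rw [i1_of_injA, i1_of_injA] <;> exact mulVecLin_inj hu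
  · rw [i1_of_injB, i1_of_injB] <;> exact mulVecLin_inj hu
  · rw [i1_of_injA, i1_of_injA] <;> exact FT_inj j
  · rw [e, i1_I, i1_I]
    have : j ≠ k := by rintro rfl; exact h rfl
    split_ifs <;> omega

open Classical in
theorem i2_S_step (k : ℕ) (P : MatrixPair) (hP : KroneckerCanonical P) (hpq : ¬ P.p < P.q) :
    i2 (k + 1) P + i2 (k + 1) P = (i2 k P + i2 (k + 2) P) +
      if P = ⟨k + 1, k + 1, Jmat (k + 1) 0, 1⟩ then 1 else 0 := by
  by_cases h : P = ⟨k + 1, k + 1, Jmat (k + 1) 0, 1⟩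
  · rw [if_pos h, h, i2_S, i2_S, i2_S]
    omega
  rw [if_neg h]
  obtain ⟨n, hn, hP⟩ := hP
  obtain ⟨j, rfl⟩ : ∃ k, n = k + 1 := ⟨n - 1, by omega⟩
  rcases hP with ⟨l, rfl⟩ | rfl | rfl | rfl
  · rw [i2_of_injA, i2_of_injA, i2_of_injA] <;> exact mulVecLin_inj isUnit_one
  · rw [i2_S, i2_S, i2_S]
    have : j ≠ k := by rintro rfl; exact h rfl
    omega
  · simp at hpq
  · rw [i2_of_injA, i2_of_injA, i2_of_injA] <;> exact FT_inj j

open Classical in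
theorem i2_R_step (k : ℕ) (l : ℂ) (P : MatrixPair) (hP : KroneckerCanonical P)
    (hpq : ¬ P.p < P.q) :
    i2 (k + 1) (subst (-l) 1 1 0 P) + i2 (k + 1) (subst (-l) 1 1 0 P) =
      (i2 k (subst (-l) 1 1 0 P) + i2 (k + 2) (subst (-l) 1 1 0 P)) +
      if P = ⟨k + 1, k + 1, 1, Jmat (k + 1) l⟩ then 1 else 0 := by
  by_cases h : P = ⟨k + 1, k + 1, 1, Jmat (k + 1) l⟩
  · rw [if_pos h, h, subst_R, sub_self, i2_S, i2_S, i2_S]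
    omega
  rw [if_neg h]
  obtain ⟨n, hn, hP⟩ := hP
  obtain ⟨j, rfl⟩ : ∃ k, n = k + 1 := ⟨n - 1, by omega⟩
  rcases hP with ⟨μ, rfl⟩ | rfl | rfl | rfl
  · rw [subst_R]
    by_cases hμ : μ = l
    · subst hμ
      rw [sub_self, i2_S, i2_S, i2_S]
      have : j ≠ k := by rintro rfl; exact h rfl
      omega
    · rw [i2_of_injA, i2_of_injA, i2_of_injA] <;>
      exact mulVecLin_inj (Jmat_isUnit _ (sub_ne_zero.2 hμ))
  · rw [i2_of_injA, i2_of_injA, i2_of_injA] <;> exact pencilS_inj (j + 1) l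
  · simp at hpq
  · rw [i2_of_injA, i2_of_injA, i2_of_injA] <;> exact pencilT_inj j l

theorem unique_list (L L' : List MatrixPair) (hL : ∀ P ∈ L, KroneckerCanonical P)
    (hL' : ∀ P ∈ L', KroneckerCanonical P)
    (hs : ∀ f, Additive f → f (MatrixPair.dsumList L) = f (MatrixPair.dsumList L')) :
    (L : Multiset MatrixPair) = (L' : Multiset MatrixPair) := by
  classical
  have hsum : ∀ f, Additive f → ((L : Multiset MatrixPair).map f).sum =
      ((L' : Multiset MatrixPair).map f).sum := fun f hf => by
    rw [← hf.sum, ← hf.sum, hs f hf]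
  replace hL : ∀ P ∈ (L : Multiset MatrixPair), KroneckerCanonical P := hL
  replace hL' : ∀ P ∈ (L' : Multiset MatrixPair), KroneckerCanonical P := hL'
  generalize (L : Multiset MatrixPair) = N at *
  generalize (L' : Multiset MatrixPair) = N' at *
  have hI : ∀ k : ℕ, N.count ⟨k + 1 - 1, k + 1, Fmat (k + 1), Gmat (k + 1)⟩ =
      N'.count ⟨k + 1 - 1, k + 1, Fmat (k + 1), Gmat (k + 1)⟩ := fun k =>
    count_eq N N' _ (i1 (k + 1)) (i1 k) (fun P hP => i1_step k P (hL P hP))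
      (fun P hP => i1_step k P (hL' P hP)) (hsum _ (i1_additive _)) (hsum _ (i1_additive _))
  have hfil : N.filter (fun P => P.p < P.q) = N'.filter (fun P => P.p < P.q) := by
    ext X
    rw [Multiset.count_filter, Multiset.count_filter]
    split_ifs with hX
    · by_cases hc : KroneckerCanonical X
      · obtain ⟨n, hn, hc⟩ := hc
        obtain ⟨j, rfl⟩ : ∃ k, n = k + 1 := ⟨n - 1, by omega⟩
        rcases hc with ⟨μ, rfl⟩ | rfl | rfl | rfl
        · simp at hX
        · simp at hX
        · exact hI j
        · simp at hX
      · rw [Multiset.count_eq_zero_of_notMem fun h => hc (hL X h),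
          Multiset.count_eq_zero_of_notMem fun h => hc (hL' X h)]
    · rfl
  have hsum2 : ∀ f, Additive f → ((N.filter (fun P => ¬ P.p < P.q)).map f).sum =
      ((N'.filter (fun P => ¬ P.p < P.q)).map f).sum := by
    intro f hf
    have h := hsum f hf
    rw [← Multiset.filter_add_not (fun P => P.p < P.q) N,
      ← Multiset.filter_add_not (fun P => P.p < P.q) N', Multiset.map_add, Multiset.map_add,
      Multiset.sum_add, Multiset.sum_add, hfil] at h
    omega
  ext X
  by_cases hc : KroneckerCanonical X
  · obtain ⟨n, hn, hc⟩ := hc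
    obtain ⟨k, rfl⟩ : ∃ k, n = k + 1 := ⟨n - 1, by omega⟩
    have main : ∀ X : MatrixPair, ¬ X.p < X.q → ∀ g : ℕ → MatrixPair → ℕ, (∀ m, Additive (g m)) →
        (∀ P, KroneckerCanonical P → ¬ P.p < P.q →
          g (k + 1) P + g (k + 1) P = (g k P + g (k + 2) P) + if P = X then 1 else 0) →
        N.count X = N'.count X := by
      intro X hX g hg hst
      have := count_eq (N.filter (fun P => ¬ P.p < P.q)) (N'.filter (fun P => ¬ P.p < P.q)) X
        (fun P => g (k + 1) P + g (k + 1) P) (fun P => g k P + g (k + 2) P)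
        (fun P hP => hst P (hL P (Multiset.mem_filter.1 hP).1) (Multiset.mem_filter.1 hP).2)
        (fun P hP => hst P (hL' P (Multiset.mem_filter.1 hP).1) (Multiset.mem_filter.1 hP).2)
        (by rw [Multiset.sum_map_add, Multiset.sum_map_add, hsum2 _ (hg _)])
        (by rw [Multiset.sum_map_add, Multiset.sum_map_add, hsum2 _ (hg _), hsum2 _ (hg _)])
      rw [Multiset.count_filter, Multiset.count_filter, if_pos hX, if_pos hX] at this
      exact this
    rcases hc with ⟨l, rfl⟩ | rfl | rfl | rfl
    · exact main _ (by simp) (fun m P => i2 m (subst (-l) 1 1 0 P))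
        (fun m => (i2_additive m).subst _ _ _ _) (i2_R_step k l)
    · exact main _ (by simp) i2 i2_additive (i2_S_step k)
    · exact hI k
    · exact count_eq N N' _ (fun P => i1 (k + 1) (tr P)) (fun P => i1 k (tr P))
        (fun P hP => i1_tr_step k P (hL P hP))
        (fun P hP => i1_tr_step k P (hL' P hP)) (hsum _ (i1_additive _).tr)
        (hsum _ (i1_additive _).tr)
  · rw [Multiset.count_eq_zero_of_notMem fun h => hc (hL X h),
      Multiset.count_eq_zero_of_notMem fun h => hc (hL' X h)]

end uniq

end Kron

/-- Kronecker's theorem: every pair of `p × q` complex matrices is simultaneously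
equivalent to a direct sum of canonical pairs, and the multiset of canonical summands
is uniquely determined (uniqueness up to permutation of summands). -/
theorem kronecker_pencil_canonical_form (p q : ℕ) (A B : Matrix (Fin p) (Fin q) ℂ) :
    ∃ L : List MatrixPair,
      (∀ P ∈ L, KroneckerCanonical P) ∧
      MatrixPair.SimEquiv ⟨p, q, A, B⟩ (MatrixPair.dsumList L) ∧
      ∀ L' : List MatrixPair, (∀ P ∈ L', KroneckerCanonical P) →
        MatrixPair.SimEquiv ⟨p, q, A, B⟩ (MatrixPair.dsumList L') →
        (L : Multiset MatrixPair) = (L' : Multiset MatrixPair) := by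
  obtain ⟨L, hL, h⟩ := Kron.exists_dec _ ⟨p, q, A, B⟩ rfl
  have hS := (Kron.KIso_iff _ _).2 h
  refine ⟨L, hL, hS, fun L' hL' hS' => ?_⟩
  exact Kron.unique_list L L' hL hL' fun f hf => (hf.sim _ _ hS).symm.trans (hf.sim _ _ hS')
end

section
/- Every pair (A,B), where A is a p×q and B a q×p complex matrix, is contragrediently equivalent to a direct sum of pairs of the forms (I_n, J_n(λ)) with λ ∈ ℂ, (J_n(0), I_n), (F_n, G_nᵀ), (F_nᵀ, G_n); moreover this direct sum is determined by (A,B) uniquely up to permutation of summands. -/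
open Matrix

/-- A pair `(A, B)` where `A` is `p × q` and `B` is `q × p`, over `ℂ`. -/
structure ContraPair where
  p : ℕ
  q : ℕ
  A : Matrix (Fin p) (Fin q) ℂ
  B : Matrix (Fin q) (Fin p) ℂ

namespace ContraPair

/-- Block-diagonal direct sum of pairs. -/
noncomputable def dsum (P Q : ContraPair) : ContraPair :=
  ⟨P.p + Q.p, P.q + Q.q,
    Matrix.reindex finSumFinEquiv finSumFinEquiv (Matrix.fromBlocks P.A 0 0 Q.A),
    Matrix.reindex finSumFinEquiv finSumFinEquiv (Matrix.fromBlocks P.B 0 0 Q.B)⟩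

/-- The empty (0×0) pair. -/
def zero : ContraPair := ⟨0, 0, 0, 0⟩

/-- Direct sum of a list of pairs. -/
noncomputable def dsumList (L : List ContraPair) : ContraPair := L.foldr dsum zero

/-- Contragredient equivalence: `Q = (R⁻¹ P.A S, S⁻¹ P.B R)` for invertible `R`, `S`.
Here `R` plays the role of `R⁻¹` (with two-sided inverse `R'` playing `R`), and
`S'` plays the role of `S⁻¹`; over `ℂ` this forces the sizes to agree. -/
def ContraEquiv (P Q : ContraPair) : Prop :=
  ∃ (R : Matrix (Fin Q.p) (Fin P.p) ℂ) (R' : Matrix (Fin P.p) (Fin Q.p) ℂ)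
    (S : Matrix (Fin P.q) (Fin Q.q) ℂ) (S' : Matrix (Fin Q.q) (Fin P.q) ℂ),
    R * R' = 1 ∧ R' * R = 1 ∧ S * S' = 1 ∧ S' * S = 1 ∧
    Q.A = R * P.A * S ∧ Q.B = S' * P.B * R'

end ContraPair

/-- Canonical pairs for contragredient equivalence:
`(I_n, J_n(λ))`, `(J_n(0), I_n)`, `(F_n, G_nᵀ)`, `(F_nᵀ, G_n)`. -/
noncomputable def ContraCanonical (P : ContraPair) : Prop :=
  ∃ n : ℕ, 1 ≤ n ∧
    ((∃ l : ℂ, P = ⟨n, n, 1, Jmat n l⟩) ∨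
      P = ⟨n, n, Jmat n 0, 1⟩ ∨
      P = ⟨n - 1, n, Fmat n, (Gmat n)ᵀ⟩ ∨
      P = ⟨n, n - 1, (Fmat n)ᵀ, Gmat n⟩)

namespace CCF

/-- Isomorphism of pairs of linear maps. -/
def Iso {U V U' V' : Type} [AddCommGroup U] [Module ℂ U] [AddCommGroup V] [Module ℂ V]
    [AddCommGroup U'] [Module ℂ U'] [AddCommGroup V'] [Module ℂ V']
    (f : U →ₗ[ℂ] V) (g : V →ₗ[ℂ] U) (f' : U' →ₗ[ℂ] V') (g' : V' →ₗ[ℂ] U') : Prop :=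
  ∃ (a : U ≃ₗ[ℂ] U') (b : V ≃ₗ[ℂ] V'), (∀ u, b (f u) = f' (a u)) ∧ ∀ v, a (g v) = g' (b v)

/-- The first pair of maps is a direct summand of the second one. -/
def HasSummand {U V U' V' : Type} [AddCommGroup U] [Module ℂ U] [AddCommGroup V] [Module ℂ V]
    [AddCommGroup U'] [Module ℂ U'] [AddCommGroup V'] [Module ℂ V']
    (f' : U' →ₗ[ℂ] V') (g' : V' →ₗ[ℂ] U') (f : U →ₗ[ℂ] V) (g : V →ₗ[ℂ] U) : Prop :=
  ∃ (iU : U' →ₗ[ℂ] U) (iV : V' →ₗ[ℂ] V) (rU : U →ₗ[ℂ] U') (rV : V →ₗ[ℂ] V'),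
    (∀ u, f (iU u) = iV (f' u)) ∧ (∀ v, g (iV v) = iU (g' v)) ∧
    (∀ u, rV (f u) = f' (rU u)) ∧ (∀ v, rU (g v) = g' (rV v)) ∧
    Function.Bijective (fun u => rU (iU u)) ∧ Function.Bijective (fun v => rV (iV v))

section abs
variable {U V U' V' U'' V'' X Y : Type} [AddCommGroup U] [Module ℂ U] [AddCommGroup V] [Module ℂ V]
    [AddCommGroup U'] [Module ℂ U'] [AddCommGroup V'] [Module ℂ V']
    [AddCommGroup U''] [Module ℂ U''] [AddCommGroup V''] [Module ℂ V'']
    [AddCommGroup X] [Module ℂ X] [AddCommGroup Y] [Module ℂ Y]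
    {f : U →ₗ[ℂ] V} {g : V →ₗ[ℂ] U} {f' : U' →ₗ[ℂ] V'} {g' : V' →ₗ[ℂ] U'}
    {f'' : U'' →ₗ[ℂ] V''} {g'' : V'' →ₗ[ℂ] U''} {x : X →ₗ[ℂ] Y} {y : Y →ₗ[ℂ] X}

theorem Iso.symm (h : Iso f g f' g') : Iso f' g' f g := by
  obtain ⟨a, b, h1, h2⟩ := h
  refine ⟨a.symm, b.symm, fun u => ?_, fun v => ?_⟩
  · rw [LinearEquiv.symm_apply_eq, h1]; simp
  · rw [LinearEquiv.symm_apply_eq, h2]; simp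

theorem Iso.trans (h : Iso f g f' g') (h' : Iso f' g' f'' g'') : Iso f g f'' g'' := by
  obtain ⟨a, b, h1, h2⟩ := h
  obtain ⟨a', b', h1', h2'⟩ := h'
  exact ⟨a.trans a', b.trans b', fun u => by simp [h1, h1'], fun v => by simp [h2, h2']⟩

theorem Iso.prod_right (h : Iso f g f' g') :
    Iso (x.prodMap f) (y.prodMap g) (x.prodMap f') (y.prodMap g') := by
  obtain ⟨a, b, h1, h2⟩ := h
  exact ⟨(LinearEquiv.refl ℂ X).prodCongr a, (LinearEquiv.refl ℂ Y).prodCongr b,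
    fun u => by simp [h1], fun v => by simp [h2]⟩

theorem HasSummand.swap (h : HasSummand f' g' f g) : HasSummand g' f' g f := by
  obtain ⟨iU, iV, rU, rV, h1, h2, h3, h4, h5, h6⟩ := h
  exact ⟨iV, iU, rV, rU, h2, h1, h4, h3, h6, h5⟩

theorem HasSummand.congr (h : HasSummand f' g' f g) (e : Iso f' g' f'' g'') :
    HasSummand f'' g'' f g := by
  obtain ⟨iU, iV, rU, rV, h1, h2, h3, h4, h5, h6⟩ := h
  obtain ⟨a, b, e1, e2⟩ := e.symm
  have e1' : ∀ u, b.symm (f' u) = f'' (a.symm u) := fun u => by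
    rw [LinearEquiv.symm_apply_eq, e1]; simp
  have e2' : ∀ u, a.symm (g' u) = g'' (b.symm u) := fun u => by
    rw [LinearEquiv.symm_apply_eq, e2]; simp
  refine ⟨iU ∘ₗ a.toLinearMap, iV ∘ₗ b.toLinearMap, a.symm.toLinearMap ∘ₗ rU,
    b.symm.toLinearMap ∘ₗ rV, ?_, ?_, ?_, ?_, ?_, ?_⟩
  · intro u; simp [h1, e1]
  · intro u; simp [h2, e2]
  · intro u; simp [h3, e1']
  · intro u; simp [h4, e2']
  · exact a.symm.bijective.comp (h5.comp a.bijective)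
  · exact b.symm.bijective.comp (h6.comp b.bijective)

theorem bij_aux (i : U' →ₗ[ℂ] U) (r : U →ₗ[ℂ] U')
    (h : Function.Bijective (fun u => r (i u))) :
    Function.Bijective (i.coprod (LinearMap.ker r).subtype) := by
  constructor
  · rw [injective_iff_map_eq_zero]
    rintro ⟨u, k, hk⟩ hu
    simp only [LinearMap.coprod_apply, Submodule.subtype_apply] at hu
    have h0 : r (i u) = 0 := by
      have := congrArg r hu
      rw [map_add, LinearMap.mem_ker.1 hk] at this
      simpa using this
    have hu0 : u = 0 := h.1 (by simpa using h0)
    subst hu0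
    simp at hu
    simp [hu]
  · intro u
    obtain ⟨u', hu'⟩ := h.2 (r u)
    refine ⟨(u', ⟨u - i u', ?_⟩), ?_⟩
    · simp only [LinearMap.mem_ker, map_sub, sub_eq_zero]; exact hu'.symm
    · simp

theorem HasSummand.split (h : HasSummand f' g' f g) :
    ∃ (K : Submodule ℂ U) (M : Submodule ℂ V) (fK : K →ₗ[ℂ] M) (gK : M →ₗ[ℂ] K),
      Iso f g (f'.prodMap fK) (g'.prodMap gK) := by
  obtain ⟨iU, iV, rU, rV, h1, h2, h3, h4, h5, h6⟩ := h
  refine ⟨LinearMap.ker rU, LinearMap.ker rV, f.restrict ?_, g.restrict ?_, ?_⟩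
  · intro u hu
    rw [LinearMap.mem_ker] at hu ⊢
    rw [h3, hu, map_zero]
  · intro u hu
    rw [LinearMap.mem_ker] at hu ⊢
    rw [h4, hu, map_zero]
  · apply Iso.symm
    refine ⟨LinearEquiv.ofBijective _ (bij_aux iU rU h5),
      LinearEquiv.ofBijective _ (bij_aux iV rV h6), ?_, ?_⟩
    · rintro ⟨u, k⟩; simp [h1]
    · rintro ⟨u, k⟩; simp [h2]

theorem finrank_ker_eq (a : U ≃ₗ[ℂ] U') (b : V ≃ₗ[ℂ] V') (h : U →ₗ[ℂ] V) (h' : U' →ₗ[ℂ] V')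
    (e : ∀ u, b (h u) = h' (a u)) :
    Module.finrank ℂ (LinearMap.ker h) = Module.finrank ℂ (LinearMap.ker h') := by
  have : LinearMap.ker h' = (LinearMap.ker h).map (a : U →ₗ[ℂ] U') := by
    ext u
    simp only [LinearMap.mem_ker, Submodule.mem_map]
    constructor
    · intro hu
      refine ⟨a.symm u, ?_, by simp⟩
      apply b.injective; rw [e]; simpa using hu
    · rintro ⟨w, hw, rfl⟩
      simp [← e, hw]
  rw [this]
  exact (LinearEquiv.finrank_map_eq a _).symm

theorem finrank_ker_prod [FiniteDimensional ℂ U] [FiniteDimensional ℂ U']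
    (h : U →ₗ[ℂ] V) (h' : U' →ₗ[ℂ] V') :
    Module.finrank ℂ (LinearMap.ker (h.prodMap h')) =
      Module.finrank ℂ (LinearMap.ker h) + Module.finrank ℂ (LinearMap.ker h') := by
  rw [LinearMap.ker_prodMap, ← Module.finrank_prod]
  exact LinearEquiv.finrank_eq
    { toFun := fun w => (⟨w.1.1, w.2.1⟩, ⟨w.1.2, w.2.2⟩)
      invFun := fun w => ⟨(w.1.1, w.2.1), ⟨w.1.2, w.2.2⟩⟩
      map_add' := fun _ _ => rfl
      map_smul' := fun _ _ => rfl }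

/-- `g f - l`. -/
def NN (f : U →ₗ[ℂ] V) (g : V →ₗ[ℂ] U) (l : ℂ) : Module.End ℂ U := g ∘ₗ f - l • LinearMap.id

theorem NN_apply (l : ℂ) (u : U) : NN f g l u = g (f u) - l • u := rfl

theorem NN_comm (l : ℂ) (k : ℕ) (u : U) : f ((NN f g l ^ k) u) = (NN g f l ^ k) (f u) := by
  induction k generalizing u with
  | zero => simp
  | succ k ih => rw [pow_succ, pow_succ, Module.End.mul_apply, Module.End.mul_apply, ih]
                 congr 1; simp [NN_apply]

theorem Iso.NN_pow (a : U ≃ₗ[ℂ] U') (b : V ≃ₗ[ℂ] V') (h1 : ∀ u, b (f u) = f' (a u))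
    (h2 : ∀ v, a (g v) = g' (b v)) (l : ℂ) (k : ℕ) (u : U) :
    a ((NN f g l ^ k) u) = (NN f' g' l ^ k) (a u) := by
  induction k generalizing u with
  | zero => simp
  | succ k ih => rw [pow_succ, pow_succ, Module.End.mul_apply, Module.End.mul_apply, ih]
                 congr 1; simp [NN_apply, h1, h2]

theorem prod_NN_pow (l : ℂ) (k : ℕ) :
    NN (f.prodMap f') (g.prodMap g') l ^ k = (NN f g l ^ k).prodMap (NN f' g' l ^ k) := by
  have : NN (f.prodMap f') (g.prodMap g') l = (NN f g l).prodMap (NN f' g' l) := by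
    ext <;> simp [NN]
  rw [this]
  induction k with
  | zero => ext <;> simp
  | succ k ih => rw [pow_succ, pow_succ, pow_succ, ih]; rfl

/-- kernel dimension invariants -/
noncomputable def k0 (f : U →ₗ[ℂ] V) (g : V →ₗ[ℂ] U) (l : ℂ) (k : ℕ) : ℤ :=
  Module.finrank ℂ (LinearMap.ker (NN f g l ^ k))

/-- kernel dimension invariants -/
noncomputable def k1 (f : U →ₗ[ℂ] V) (g : V →ₗ[ℂ] U) (k : ℕ) : ℤ :=
  Module.finrank ℂ (LinearMap.ker (f ∘ₗ (NN f g 0 ^ k)))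

theorem Iso.k0_eq (h : Iso f g f' g') (l : ℂ) (k : ℕ) : k0 f g l k = k0 f' g' l k := by
  obtain ⟨a, b, h1, h2⟩ := h
  unfold k0
  rw [finrank_ker_eq a a _ _ (Iso.NN_pow a b h1 h2 l k)]

theorem Iso.k1_eq (h : Iso f g f' g') (k : ℕ) : k1 f g k = k1 f' g' k := by
  obtain ⟨a, b, h1, h2⟩ := h
  unfold k1
  rw [finrank_ker_eq a b]
  intro u
  simp [h1, Iso.NN_pow a b h1 h2 0 k]

theorem Iso.swap (h : Iso f g f' g') : Iso g f g' f' := by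
  obtain ⟨a, b, h1, h2⟩ := h
  exact ⟨b, a, h2, h1⟩

theorem k0_prod [FiniteDimensional ℂ U] [FiniteDimensional ℂ U'] (l : ℂ) (k : ℕ) :
    k0 (f.prodMap f') (g.prodMap g') l k = k0 f g l k + k0 f' g' l k := by
  unfold k0
  rw [prod_NN_pow, finrank_ker_prod]; simp

theorem k1_prod [FiniteDimensional ℂ U] [FiniteDimensional ℂ U'] (k : ℕ) :
    k1 (f.prodMap f') (g.prodMap g') k = k1 f g k + k1 f' g' k := by
  unfold k1
  rw [prod_NN_pow, LinearMap.prodMap_comp, finrank_ker_prod]; simp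

/-- if `gf - m` is nilpotent, `gf - l` is injective -/
theorem NN_inj {l m : ℂ} (hlm : m ≠ l) {k : ℕ} (h : NN f g m ^ k = 0) (u : U)
    (hu : NN f g l u = 0) : u = 0 := by
  have h1 : NN f g m u = (l - m) • u := by
    rw [NN_apply, sub_eq_zero] at hu
    rw [NN_apply, hu, sub_smul]
  have h2 : ∀ j : ℕ, (NN f g m ^ j) u = (l - m) ^ j • u := by
    intro j
    induction j with
    | zero => simp
    | succ j ih => rw [pow_succ, Module.End.mul_apply, h1, map_smul, ih, smul_smul, pow_succ']
  have h3 := h2 k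
  rw [h] at h3
  have h4 : (l - m) ^ k ≠ 0 := pow_ne_zero _ (sub_ne_zero.2 hlm.symm)
  simpa [h4] using h3.symm

theorem k0_zero_of_nil {l m : ℂ} (hlm : m ≠ l) {k : ℕ} (h : NN f g m ^ k = 0) (j : ℕ) :
    k0 f g l j = 0 := by
  unfold k0
  have : LinearMap.ker (NN f g l ^ j) = ⊥ := by
    rw [LinearMap.ker_eq_bot, Module.End.coe_pow]
    apply Function.Injective.iterate
    rw [injective_iff_map_eq_zero]
    exact fun u hu => NN_inj hlm h u hu
  rw [this]; simp

theorem k1_zero_of_nil {m : ℂ} (hlm : m ≠ 0) {k : ℕ} (h : NN f g m ^ k = 0) (j : ℕ) :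
    k1 f g j = 0 := by
  unfold k1
  have h0 : Function.Injective (NN f g 0) := by
    rw [injective_iff_map_eq_zero]
    exact fun u hu => NN_inj hlm h u hu
  have : LinearMap.ker (f ∘ₗ (NN f g 0 ^ j)) = ⊥ := by
    rw [LinearMap.ker_eq_bot, LinearMap.coe_comp, Module.End.coe_pow]
    apply Function.Injective.comp
    · rw [injective_iff_map_eq_zero]
      intro u hu
      apply (injective_iff_map_eq_zero _).1 h0
      rw [NN_apply, hu]; simp
    · exact h0.iterate _
  rw [this]; simp

end abs

/-- The linear map of `A`. -/
noncomputable def lf (P : ContraPair) : (Fin P.q → ℂ) →ₗ[ℂ] (Fin P.p → ℂ) := P.A.mulVecLin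
/-- The linear map of `B`. -/
noncomputable def lg (P : ContraPair) : (Fin P.p → ℂ) →ₗ[ℂ] (Fin P.q → ℂ) := P.B.mulVecLin

theorem equiv_iff (P Q : ContraPair) : P.ContraEquiv Q ↔ Iso (lf P) (lg P) (lf Q) (lg Q) := by
  constructor
  · rintro ⟨R, R', S, S', h1, h2, h3, h4, hA, hB⟩
    refine ⟨LinearEquiv.ofLinearMap S'.mulVecLin S.mulVecLin ?_ ?_,
      LinearEquiv.ofLinearMap R.mulVecLin R'.mulVecLin ?_ ?_, ?_, ?_⟩
    · rw [← Matrix.mulVecLin_mul, h4, Matrix.mulVecLin_one]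
    · rw [← Matrix.mulVecLin_mul, h3, Matrix.mulVecLin_one]
    · rw [← Matrix.mulVecLin_mul, h1, Matrix.mulVecLin_one]
    · rw [← Matrix.mulVecLin_mul, h2, Matrix.mulVecLin_one]
    · intro u
      simp [lf, hA, Matrix.mul_assoc, h3]
    · intro u
      simp [lg, hB, Matrix.mul_assoc, h2]
  · rintro ⟨a, b, h1, h2⟩
    refine ⟨LinearMap.toMatrix' b.toLinearMap, LinearMap.toMatrix' b.symm.toLinearMap,
      LinearMap.toMatrix' a.symm.toLinearMap, LinearMap.toMatrix' a.toLinearMap, ?_, ?_, ?_, ?_, ?_, ?_⟩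
    · rw [← LinearMap.toMatrix'_comp]; simp
    · rw [← LinearMap.toMatrix'_comp]; simp
    · rw [← LinearMap.toMatrix'_comp]; simp
    · rw [← LinearMap.toMatrix'_comp]; simp
    · apply Matrix.toLin'.injective
      apply LinearMap.ext
      intro u
      have := h1 (a.symm u)
      simp [lf] at this
      simp [Matrix.toLin'_mul, ← this]
    · apply Matrix.toLin'.injective
      apply LinearMap.ext
      intro u
      have := h2 (b.symm u)
      simp [lg] at this
      simp [Matrix.toLin'_mul, ← this]

/-- gluing of coordinates -/
noncomputable def glue (m n : ℕ) : ((Fin m → ℂ) × (Fin n → ℂ)) ≃ₗ[ℂ] (Fin (m + n) → ℂ) :=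
  (LinearEquiv.sumArrowLequivProdArrow (Fin m) (Fin n) ℂ ℂ).symm.trans
    (LinearEquiv.funCongrLeft ℂ ℂ finSumFinEquiv.symm)

theorem glue_apply (m n : ℕ) (u : Fin m → ℂ) (v : Fin n → ℂ) :
    glue m n (u, v) = Sum.elim u v ∘ finSumFinEquiv.symm := rfl

theorem blk {p q p' q' : ℕ} (A : Matrix (Fin p) (Fin q) ℂ) (A' : Matrix (Fin p') (Fin q') ℂ)
    (u : Fin q → ℂ) (v : Fin q' → ℂ) :
    Sum.elim (A *ᵥ u) (A' *ᵥ v) ∘ finSumFinEquiv.symm =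
    (Matrix.reindex finSumFinEquiv finSumFinEquiv (Matrix.fromBlocks A 0 0 A')) *ᵥ
      (Sum.elim u v ∘ finSumFinEquiv.symm) := by
  rw [Matrix.reindex_apply, Matrix.submatrix_mulVec_equiv, Function.comp_assoc]
  simp [Matrix.fromBlocks_mulVec]

theorem dsum_iso (P Q : ContraPair) :
    Iso ((lf P).prodMap (lf Q)) ((lg P).prodMap (lg Q)) (lf (P.dsum Q)) (lg (P.dsum Q)) := by
  refine ⟨glue _ _, glue _ _, ?_, ?_⟩
  · rintro ⟨u, v⟩
    exact blk P.A Q.A u v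
  · rintro ⟨u, v⟩
    exact blk P.B Q.B u v

/-- indices of canonical blocks (size is `m+1`) -/
inductive Idx where
  | t1 (m : ℕ) (l : ℂ)
  | t2 (m : ℕ)
  | t3 (m : ℕ)
  | t4 (m : ℕ)

/-- the canonical block -/
noncomputable def Idx.toPair : Idx → ContraPair
  | .t1 m l => ⟨m + 1, m + 1, 1, Jmat (m + 1) l⟩
  | .t2 m => ⟨m + 1, m + 1, Jmat (m + 1) 0, 1⟩
  | .t3 m => ⟨m + 1 - 1, m + 1, Fmat (m + 1), (Gmat (m + 1))ᵀ⟩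
  | .t4 m => ⟨m + 1, m + 1 - 1, (Fmat (m + 1))ᵀ, Gmat (m + 1)⟩

theorem Idx.canon (c : Idx) : ContraCanonical c.toPair := by
  cases c with
  | t1 m l => exact ⟨m + 1, by omega, Or.inl ⟨l, rfl⟩⟩
  | t2 m => exact ⟨m + 1, by omega, Or.inr (Or.inl rfl)⟩
  | t3 m => exact ⟨m + 1, by omega, Or.inr (Or.inr (Or.inl rfl))⟩
  | t4 m => exact ⟨m + 1, by omega, Or.inr (Or.inr (Or.inr rfl))⟩

theorem canon_idx (P : ContraPair) (h : ContraCanonical P) : ∃ c : Idx, c.toPair = P := by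
  obtain ⟨n, hn, h⟩ := h
  obtain ⟨m, rfl⟩ : ∃ m, n = m + 1 := ⟨n - 1, by omega⟩
  rcases h with ⟨l, rfl⟩ | rfl | rfl | rfl
  · exact ⟨.t1 m l, rfl⟩
  · exact ⟨.t2 m, rfl⟩
  · exact ⟨.t3 m, rfl⟩
  · exact ⟨.t4 m, rfl⟩

theorem canon_list (L : List ContraPair) (h : ∀ P ∈ L, ContraCanonical P) :
    ∃ L0 : List Idx, L0.map Idx.toPair = L := by
  induction L with
  | nil => exact ⟨[], rfl⟩
  | cons P L ih =>
    obtain ⟨L0, h0⟩ := ih fun Q hQ => h Q (List.mem_cons_of_mem _ hQ)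
    obtain ⟨c, hc⟩ := canon_idx P (h P (by simp))
    exact ⟨c :: L0, by simp [h0, hc]⟩

/-- extension by zero -/
noncomputable def ex {n : ℕ} (w : Fin n → ℂ) (i : ℕ) : ℂ := if h : i < n then w ⟨i, h⟩ else 0

theorem ex_val {n : ℕ} (w : Fin n → ℂ) (i : Fin n) : ex w i = w i := by simp [ex]

theorem ex_lt {n : ℕ} (w : Fin n → ℂ) {i : ℕ} (h : i < n) : ex w i = w ⟨i, h⟩ := by simp [ex, h]

theorem ex_ge {n : ℕ} (w : Fin n → ℂ) {i : ℕ} (h : n ≤ i) : ex w i = 0 := by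
  simp [ex, not_lt.2 h]

theorem sum_ex {n : ℕ} (w : Fin n → ℂ) (i : ℕ) :
    ∑ x : Fin n, (if (x : ℕ) = i then 1 else 0) * w x = ex w i := by
  by_cases h : i < n
  · rw [ex_lt w h, Finset.sum_eq_single ⟨i, h⟩]
    · simp
    · intro b _ hb
      rw [if_neg (fun h' => hb (Fin.ext h')), zero_mul]
    · simp
  · rw [ex_ge w (not_lt.1 h)]
    apply Finset.sum_eq_zero
    intro x _
    rw [if_neg (by omega), zero_mul]

theorem sum_ex' {n : ℕ} (w : Fin n → ℂ) (i : ℕ) :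
    ∑ x : Fin n, (if i = (x : ℕ) then 1 else 0) * w x = ex w i := by
  rw [← sum_ex]; simp only [eq_comm]

theorem J_mulVec (n : ℕ) (l : ℂ) (w : Fin n → ℂ) (j : Fin n) :
    (Jmat n l *ᵥ w) j = l * w j + ex w (j + 1) := by
  rw [← sum_ex w (j + 1), ← ex_val w j, ← sum_ex w j, Finset.mul_sum, ← Finset.sum_add_distrib]
  simp only [Matrix.mulVec, dotProduct, Jmat, Matrix.of_apply]
  apply Finset.sum_congr rfl
  intro x _
  split_ifs <;> first | omega | simp

/-- maps of type 1 -/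
noncomputable def f1 (m : ℕ) : (Fin (m + 1) → ℂ) →ₗ[ℂ] (Fin (m + 1) → ℂ) :=
  (1 : Matrix (Fin (m + 1)) (Fin (m + 1)) ℂ).mulVecLin
/-- maps of type 1 -/
noncomputable def g1 (m : ℕ) (l : ℂ) : (Fin (m + 1) → ℂ) →ₗ[ℂ] (Fin (m + 1) → ℂ) :=
  (Jmat (m + 1) l).mulVecLin
/-- maps of type 3 -/
noncomputable def f3 (m : ℕ) : (Fin (m + 1) → ℂ) →ₗ[ℂ] (Fin m → ℂ) := (Fmat (m + 1)).mulVecLin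
/-- maps of type 3 -/
noncomputable def g3 (m : ℕ) : (Fin m → ℂ) →ₗ[ℂ] (Fin (m + 1) → ℂ) := (Gmat (m + 1))ᵀ.mulVecLin
/-- maps of type 4 -/
noncomputable def f4 (m : ℕ) : (Fin m → ℂ) →ₗ[ℂ] (Fin (m + 1) → ℂ) := (Fmat (m + 1))ᵀ.mulVecLin
/-- maps of type 4 -/
noncomputable def g4 (m : ℕ) : (Fin (m + 1) → ℂ) →ₗ[ℂ] (Fin m → ℂ) := (Gmat (m + 1)).mulVecLin

theorem t1_f (m : ℕ) (w : Fin (m + 1) → ℂ) : f1 m w = w := by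
  simp [f1]

theorem t1_g (m : ℕ) (l : ℂ) (w : Fin (m + 1) → ℂ) (j : Fin (m + 1)) :
    g1 m l w j = l * w j + ex w (j + 1) := J_mulVec _ _ _ _

theorem t3_f (m : ℕ) (w : Fin (m + 1) → ℂ) (j : Fin m) :
    f3 m w j = ex w j := sum_ex w j

theorem t3_g (m : ℕ) (w : Fin m → ℂ) (j : Fin (m + 1)) :
    g3 m w j = if (j : ℕ) = 0 then 0 else ex w (j - 1) := by
  rw [← sum_ex]
  change ∑ x : Fin m, (if (j : ℕ) = (x : ℕ) + 1 then 1 else 0) * w x = _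
  split_ifs with h
  · apply Finset.sum_eq_zero
    intro x _
    rw [if_neg (by omega), zero_mul]
  · apply Finset.sum_congr rfl
    intro x _
    congr 1
    split_ifs <;> first | rfl | omega

theorem t4_f (m : ℕ) (w : Fin m → ℂ) (j : Fin (m + 1)) :
    f4 m w j = ex w j := sum_ex' w j

theorem t4_g (m : ℕ) (w : Fin (m + 1) → ℂ) (j : Fin m) :
    g4 m w j = ex w (j + 1) := sum_ex w (j + 1)

theorem t4_swap (m : ℕ) : Iso (g3 m) (f3 m) (f4 m) (g4 m) := by
  refine ⟨LinearEquiv.funCongrLeft ℂ ℂ (Fin.revPerm (n := m)),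
    LinearEquiv.funCongrLeft ℂ ℂ (Fin.revPerm (n := m + 1)), fun u => ?_, fun v => ?_⟩
  · ext j
    rw [t4_f]
    change g3 m u (Fin.rev j) = _
    rw [t3_g, Fin.val_rev]
    by_cases hj : (j : ℕ) < m
    · rw [if_neg (by omega), ex_lt _ (by omega), ex_lt _ hj]
      change _ = u (Fin.rev _)
      congr 1
      ext
      simp [Fin.val_rev]; omega
    · rw [if_pos (by omega), ex_ge _ (by omega)]
  · ext j
    rw [t4_g]
    change f3 m v (Fin.rev j) = _
    rw [t3_f, Fin.val_rev, ex_lt _ (by omega), ex_lt _ (by omega)]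
    change _ = v (Fin.rev _)
    congr 1
    ext
    simp [Fin.val_rev]; try omega

theorem tri_bij {n : ℕ} (h : (Fin n → ℂ) → (Fin n → ℂ)) (M : Matrix (Fin n) (Fin n) ℂ)
    (hM : ∀ w i, h w i = ∑ j, w j * M i j)
    (h0 : (∀ i j, j < i → M i j = 0) ∨ (∀ i j, i < j → M i j = 0)) (h1 : ∀ i, M i i ≠ 0) :
    Function.Bijective h := by
  have hd : M.det ≠ 0 := by
    rcases h0 with h0 | h0
    · rw [Matrix.det_of_isUpperTriangular (fun i j hij => h0 i j hij)]
      exact Finset.prod_ne_zero_iff.2 fun i _ => h1 i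
    · rw [Matrix.det_of_isLowerTriangular M (fun i j hij => h0 i j hij)]
      exact Finset.prod_ne_zero_iff.2 fun i _ => h1 i
  have hh : h = M.mulVec := by
    ext w i
    rw [hM]
    simp [Matrix.mulVec, dotProduct, mul_comm]
  have hu : IsUnit M := (Matrix.isUnit_iff_isUnit_det M).2 (isUnit_iff_ne_zero.2 hd)
  rw [hh]
  exact ⟨Matrix.mulVec_injective_iff_isUnit.2 hu, Matrix.mulVec_surjective_iff_isUnit.2 hu⟩

section summands
variable {U V : Type} [AddCommGroup U] [Module ℂ U] [AddCommGroup V] [Module ℂ V]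
    {f : U →ₗ[ℂ] V} {g : V →ₗ[ℂ] U}

theorem gf_eq (l : ℂ) (k : ℕ) (u : U) :
    g (f ((NN f g l ^ k) u)) = l • (NN f g l ^ k) u + (NN f g l ^ (k + 1)) u := by
  rw [pow_succ', Module.End.mul_apply, NN_apply]; abel

/-- linear combination map -/
noncomputable def lc {n : ℕ} (b : Fin n → U) : (Fin n → ℂ) →ₗ[ℂ] U :=
  Fintype.linearCombination ℂ b

theorem lc_apply {n : ℕ} (b : Fin n → U) (w : Fin n → ℂ) : lc b w = ∑ j, w j • b j := rfl

theorem pow_ge_zero (N : Module.End ℂ U) {x : U} {a b : ℕ} (hab : a ≤ b) (h : (N ^ a) x = 0) :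
    (N ^ b) x = 0 := by
  obtain ⟨c, rfl⟩ := Nat.exists_eq_add_of_le' hab
  rw [pow_add, Module.End.mul_apply, h, map_zero]

theorem summand1 (m : ℕ) (l : ℂ) (x : U) (φ : V →ₗ[ℂ] ℂ)
    (hx : (NN f g l ^ (m + 1)) x = 0) (hφ : ∀ v, φ ((NN g f l ^ (m + 1)) v) = 0)
    (hne : φ (f ((NN f g l ^ m) x)) ≠ 0) : HasSummand (f1 m) (g1 m l) f g := by
  have hbij : ∀ h : (Fin (m + 1) → ℂ) → (Fin (m + 1) → ℂ),
      (∀ w i, h w i = ∑ j, w j * φ (f ((NN f g l ^ ((i : ℕ) + (m - j))) x))) →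
      Function.Bijective h := by
    intro h hh
    refine tri_bij h (fun i j => φ (f ((NN f g l ^ ((i : ℕ) + (m - j))) x))) hh (Or.inl ?_) ?_
    · intro i j hij
      rw [pow_ge_zero _ _ hx, map_zero, map_zero]
      have := Fin.lt_def.1 hij
      omega
    · intro i
      rwa [show (i : ℕ) + (m - i) = m by omega]
  refine ⟨lc fun j => (NN f g l ^ (m - (j : ℕ))) x, lc fun j => f ((NN f g l ^ (m - (j : ℕ))) x),
    LinearMap.pi fun j => φ ∘ₗ f ∘ₗ (NN f g l ^ (j : ℕ)),
    LinearMap.pi fun j => φ ∘ₗ (NN g f l ^ (j : ℕ)), ?_, ?_, ?_, ?_, ?_, ?_⟩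
  · intro u
    simp [lc_apply, t1_f]
  · intro v
    simp only [lc_apply, map_sum, map_smul, gf_eq, t1_g, add_smul, smul_add, Finset.sum_add_distrib]
    congr 1
    · apply Finset.sum_congr rfl
      intro j _
      rw [smul_smul, mul_comm]
    · rw [Fin.sum_univ_succ, Fin.sum_univ_castSucc]
      simp only [Fin.val_zero, Nat.sub_zero, hx, smul_zero, zero_add, Fin.val_last]
      rw [ex_ge _ le_rfl, zero_smul, add_zero]
      apply Finset.sum_congr rfl
      intro j _
      rw [ex_lt _ (by simp)]
      simp only [Fin.val_succ, Fin.val_castSucc]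
      rw [show m - ((j : ℕ) + 1) + 1 = m - j by omega]
      rfl
  · intro u
    ext j
    simp [t1_f, NN_comm]
  · intro v
    ext j
    rw [t1_g]
    have key : φ (f ((NN f g l ^ (j : ℕ)) (g v))) =
        l * φ ((NN g f l ^ (j : ℕ)) v) + φ ((NN g f l ^ ((j : ℕ) + 1)) v) := by
      rw [NN_comm, pow_succ, Module.End.mul_apply, NN_apply, map_sub, map_smul, map_sub, map_smul]
      simp
    simp only [LinearMap.pi_apply, LinearMap.comp_apply, key]
    congr 1
    by_cases hj : (j : ℕ) + 1 < m + 1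
    · rw [ex_lt _ hj]; rfl
    · rw [ex_ge _ (by omega), show (j : ℕ) + 1 = m + 1 by omega, hφ]
  · apply hbij
    intro w i
    simp [lc_apply, pow_add]
  · apply hbij
    intro w i
    simp [lc_apply, pow_add, ← NN_comm]

theorem summand3 (m : ℕ) (x : U) (φ : U →ₗ[ℂ] ℂ)
    (hx : f ((NN f g 0 ^ m) x) = 0) (hφ : ∀ v, φ ((NN f g 0 ^ m) (g v)) = 0)
    (hne : φ ((NN f g 0 ^ m) x) ≠ 0) : HasSummand (f3 m) (g3 m) f g := by
  have hx' : (NN f g 0 ^ (m + 1)) x = 0 := by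
    rw [pow_succ', Module.End.mul_apply, NN_apply, hx]; simp
  have gf : ∀ k u, g (f ((NN f g 0 ^ k) u)) = (NN f g 0 ^ (k + 1)) u := by
    intro k u; rw [gf_eq]; simp
  have gf' : ∀ k u, (NN f g 0 ^ k) (g (f u)) = (NN f g 0 ^ (k + 1)) u := by
    intro k u; rw [pow_succ, Module.End.mul_apply, NN_apply]; simp
  refine ⟨lc fun j => (NN f g 0 ^ (j : ℕ)) x, lc fun j => f ((NN f g 0 ^ (j : ℕ)) x),
    LinearMap.pi fun j => φ ∘ₗ (NN f g 0 ^ (m - (j : ℕ))),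
    LinearMap.pi fun j => φ ∘ₗ (NN f g 0 ^ (m - 1 - (j : ℕ))) ∘ₗ g, ?_, ?_, ?_, ?_, ?_, ?_⟩
  · intro u
    simp only [lc_apply, map_sum, map_smul]
    rw [Fin.sum_univ_castSucc]
    simp only [Fin.val_last, hx, smul_zero, add_zero]
    apply Finset.sum_congr rfl
    intro j _
    rw [t3_f, ex_lt _ (by omega)]
    rfl
  · intro v
    simp only [lc_apply, map_sum, map_smul, gf]
    rw [Fin.sum_univ_succ]
    simp only [t3_g]
    simp [ex_val]
  · intro u
    ext j
    rw [t3_f, ex_lt _ (by omega)]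
    simp only [LinearMap.pi_apply, LinearMap.comp_apply, gf']
    rw [show m - 1 - (j : ℕ) + 1 = m - j by omega]
  · intro v
    ext j
    rw [t3_g]
    simp only [LinearMap.pi_apply, LinearMap.comp_apply]
    split_ifs with hj
    · rw [hj]; exact hφ v
    · rw [ex_lt _ (by omega)]
      simp only [LinearMap.pi_apply, LinearMap.comp_apply]
      rw [show m - 1 - ((j : ℕ) - 1) = m - j by omega]
  · refine tri_bij _ (fun i j => φ ((NN f g 0 ^ (m - (i : ℕ) + j)) x)) ?_ (Or.inr ?_) ?_
    · intro w i
      simp [lc_apply, pow_add]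
    · intro i j hij
      rw [pow_ge_zero _ _ hx', map_zero]
      have := Fin.lt_def.1 hij
      omega
    · intro i
      rwa [show m - (i : ℕ) + i = m by omega]
  · refine tri_bij _ (fun i j => φ ((NN f g 0 ^ (m - (i : ℕ) + j)) x)) ?_ (Or.inr ?_) ?_
    · intro w i
      simp only [lc_apply, LinearMap.pi_apply, LinearMap.comp_apply, map_sum, map_smul, gf,
        smul_eq_mul]
      apply Finset.sum_congr rfl
      intro j _
      rw [← Module.End.mul_apply, ← pow_add,
        show m - 1 - (i : ℕ) + (j + 1) = m - i + j by omega]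
    · intro i j hij
      rw [pow_ge_zero _ _ hx', map_zero]
      have := Fin.lt_def.1 hij
      omega
    · intro i
      rwa [show m - (i : ℕ) + i = m by omega]

theorem exists_functional [FiniteDimensional ℂ U] (W : Submodule ℂ U) (x : U) (hx : x ∉ W) :
    ∃ φ : U →ₗ[ℂ] ℂ, φ x ≠ 0 ∧ ∀ w ∈ W, φ w = 0 := by
  obtain ⟨φ, h1, h2⟩ := Submodule.exists_le_ker_of_notMem hx
  exact ⟨φ, h1, fun w hw => h2 hw⟩

theorem exists_functional' (x : U) (hx : x ≠ 0) :
    ∃ φ : U →ₗ[ℂ] ℂ, φ x ≠ 0 := by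
  by_contra! h
  exact hx ((Module.forall_dual_apply_eq_zero_iff ℂ x).1 h)

/-- existence of a summand -/
theorem exists_summand [FiniteDimensional ℂ U] [FiniteDimensional ℂ V]
    (h : Nontrivial U ∨ Nontrivial V) :
    ∃ c : Idx, HasSummand (lf c.toPair) (lg c.toPair) f g := by
  by_cases hev : ∃ l : ℂ, l ≠ 0 ∧ ∃ u : U, u ≠ 0 ∧ NN f g l u = 0
  · obtain ⟨l, hl, u, hu, hul⟩ := hev
    have hex : ∃ n, LinearMap.ker (NN f g l ^ n) = LinearMap.ker (NN f g l ^ (n + 1)) := by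
      obtain ⟨k, -, hk⟩ := Module.End.exists_ker_pow_eq_ker_pow_succ (NN f g l)
      exact ⟨k, hk⟩
    classical
    have hmin := fun k => Nat.find_min hex (m := k)
    have hn := Nat.find_spec hex
    generalize Nat.find hex = n at hmin hn
    cases n with
    | zero =>
      exfalso
      have : u ∈ LinearMap.ker (NN f g l ^ (0 + 1)) := by simpa using hul
      rw [← hn] at this
      exact hu (by simpa using this)
    | succ m =>
      have hm := hmin m (by omega)
      have hle : LinearMap.ker (NN f g l ^ m) ≤ LinearMap.ker (NN f g l ^ (m + 1)) :=
        fun y hy => pow_ge_zero _ (by omega) hy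
      obtain ⟨x, hx, hx'⟩ := SetLike.exists_of_lt (lt_of_le_of_ne hle hm)
      rw [LinearMap.mem_ker] at hx hx'
      have hnot : (NN f g l ^ m) x ∉ LinearMap.range (NN f g l ^ (m + 1)) := by
        rintro ⟨z, hz⟩
        have hz2 : z ∈ LinearMap.ker (NN f g l ^ (m + 1 + 1)) := by
          rw [LinearMap.mem_ker, pow_succ', Module.End.mul_apply, hz, ← Module.End.mul_apply,
            ← pow_succ', hx]
        rw [← hn, LinearMap.mem_ker, hz] at hz2
        exact hx' hz2
      obtain ⟨ψ, h1, h2⟩ := exists_functional _ _ hnot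
      refine ⟨.t1 m l, summand1 m l x (ψ ∘ₗ g) hx ?_ ?_⟩
      · intro v
        rw [LinearMap.comp_apply, NN_comm]
        exact h2 _ ⟨_, rfl⟩
      · rw [LinearMap.comp_apply, gf_eq, hx, add_zero, map_smul]
        exact mul_ne_zero hl h1
  · push Not at hev
    have hnil : IsNilpotent (NN f g 0) := by
      rw [Module.End.isNilpotent_iff_of_finite]
      intro u
      have ht := Module.End.iSup_maxGenEigenspace_eq_top (NN f g 0)
      have hb : ∀ l : ℂ, Module.End.maxGenEigenspace (NN f g 0) l ≤
          Module.End.maxGenEigenspace (NN f g 0) 0 := by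
        intro l
        by_cases hl : l = 0
        · rw [hl]
        · intro y hy
          rw [Module.End.mem_maxGenEigenspace] at hy
          obtain ⟨k, hk⟩ := hy
          have he : NN f g 0 - l • 1 = NN f g l := by ext; simp [NN]
          have hinj : Function.Injective (NN f g l ^ k) := by
            rw [Module.End.coe_pow]
            apply Function.Injective.iterate
            rw [injective_iff_map_eq_zero]
            intro z hz
            by_contra hz0
            exact hev l hl z hz0 hz
          rw [he] at hk
          have hy0 : y = 0 := (injective_iff_map_eq_zero _).1 hinj y hk
          rw [hy0]
          exact Submodule.zero_mem _
      have hu : u ∈ Module.End.maxGenEigenspace (NN f g 0) 0 := by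
        have h2 := iSup_le hb
        rw [ht] at h2
        exact h2 Submodule.mem_top
      simpa [Module.End.mem_maxGenEigenspace] using hu
    have hex : ∃ n, NN f g 0 ^ n = 0 ∧ NN g f 0 ^ n = 0 := by
      obtain ⟨n, hn⟩ := hnil
      refine ⟨n + 1, by rw [pow_succ, hn, zero_mul], ?_⟩
      ext v
      rw [pow_succ, Module.End.mul_apply, NN_apply, zero_smul, sub_zero, ← NN_comm, hn]
      simp
    classical
    have hmin := fun k => Nat.find_min hex (m := k)
    have hn := Nat.find_spec hex
    generalize Nat.find hex = n at hmin hn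
    cases n with
    | zero =>
      exfalso
      rcases h with h | h
      · exact one_ne_zero hn.1
      · exact one_ne_zero hn.2
    | succ m =>
      have hm := hmin m (by omega)
      by_cases c1 : ∀ u, f ((NN f g 0 ^ m) u) = 0
      · by_cases c2 : ∀ v, g ((NN g f 0 ^ m) v) = 0
        · by_cases c3 : NN f g 0 ^ m = 0
          · have c4 : NN g f 0 ^ m ≠ 0 := fun c4 => hm ⟨c3, c4⟩
            obtain ⟨x, hx⟩ := DFunLike.ne_iff.1 c4
            obtain ⟨φ, hφ⟩ := exists_functional' _ hx
            exact ⟨.t4 m, ((summand3 m x φ (c2 x) (fun v => by rw [← NN_comm, c1, map_zero])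
              hφ).swap).congr (t4_swap m)⟩
          · obtain ⟨x, hx⟩ := DFunLike.ne_iff.1 c3
            obtain ⟨φ, hφ⟩ := exists_functional' _ hx
            exact ⟨.t3 m, summand3 m x φ (c1 x) (fun v => by rw [← NN_comm, c2, map_zero]) hφ⟩
        · push Not at c2
          obtain ⟨x, hx⟩ := c2
          obtain ⟨φ, hφ⟩ := exists_functional' _ hx
          exact ⟨.t2 m, (summand1 m 0 x φ (by rw [hn.2]; rfl) (fun v => by rw [hn.1]; simp) hφ).swap⟩
      · push Not at c1
        obtain ⟨x, hx⟩ := c1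
        obtain ⟨φ, hφ⟩ := exists_functional' _ hx
        exact ⟨.t1 m 0, summand1 m 0 x φ (by rw [hn.1]; rfl) (fun v => by rw [hn.2]; simp) hφ⟩

end summands

theorem exists_list (N : ℕ) : ∀ (U V : Type) [AddCommGroup U] [Module ℂ U] [AddCommGroup V]
    [Module ℂ V] [FiniteDimensional ℂ U] [FiniteDimensional ℂ V]
    (f : U →ₗ[ℂ] V) (g : V →ₗ[ℂ] U), Module.finrank ℂ U + Module.finrank ℂ V = N →
    ∃ L : List Idx, Iso f g (lf (ContraPair.dsumList (L.map Idx.toPair)))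
      (lg (ContraPair.dsumList (L.map Idx.toPair))) := by
  induction N using Nat.strong_induction_on with
  | _ N ih =>
    intro U V _ _ _ _ _ _ f g hN
    by_cases h : Nontrivial U ∨ Nontrivial V
    · obtain ⟨c, hc⟩ := exists_summand (f := f) (g := g) h
      obtain ⟨K, M, fK, gK, e⟩ := hc.split
      have hlt : Module.finrank ℂ K + Module.finrank ℂ M < N := by
        obtain ⟨a, b, -, -⟩ := e
        have h1 := a.finrank_eq
        have h2 := b.finrank_eq
        rw [Module.finrank_prod, Module.finrank_fin_fun] at h1 h2
        have : 0 < c.toPair.p + c.toPair.q := by cases c <;> simp [Idx.toPair]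
        omega
      obtain ⟨L, hL⟩ := ih _ hlt K M fK gK rfl
      exact ⟨c :: L, (e.trans hL.prod_right).trans (dsum_iso _ _)⟩
    · rw [not_or, not_nontrivial_iff_subsingleton, not_nontrivial_iff_subsingleton] at h
      obtain ⟨h1, h2⟩ := h
      refine ⟨[], ?_⟩
      change Iso f g (lf ContraPair.zero) (lg ContraPair.zero)
      have : Subsingleton (Fin ContraPair.zero.p → ℂ) :=
        inferInstanceAs (Subsingleton (Fin 0 → ℂ))
      have : Subsingleton (Fin ContraPair.zero.q → ℂ) :=
        inferInstanceAs (Subsingleton (Fin 0 → ℂ))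
      exact ⟨⟨0, 0, fun _ => Subsingleton.elim _ _, fun _ => Subsingleton.elim _ _⟩,
        ⟨0, 0, fun _ => Subsingleton.elim _ _, fun _ => Subsingleton.elim _ _⟩,
        fun _ => Subsingleton.elim _ _, fun _ => Subsingleton.elim _ _⟩

theorem finrank_shift {n b k : ℕ} (h : (Fin n → ℂ) →ₗ[ℂ] (Fin b → ℂ))
    (hh : ∀ w j, h w j = ex w (j + k)) (hb : n ≤ b + k) :
    Module.finrank ℂ (LinearMap.ker h) = min n k := by
  have hmem : ∀ w, w ∈ LinearMap.ker h ↔ ∀ i : Fin n, k ≤ (i : ℕ) → w i = 0 := by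
    intro w
    rw [LinearMap.mem_ker]
    constructor
    · intro hw i hi
      have := congrFun hw ⟨i - k, by omega⟩
      rw [hh] at this
      simpa [Nat.sub_add_cancel hi, ex_val] using this
    · intro hw
      ext j
      rw [hh]
      by_cases hj : (j : ℕ) + k < n
      · rw [ex_lt _ hj]; exact hw _ (by simp)
      · rw [ex_ge _ (by omega)]; rfl
  have e : LinearMap.ker h ≃ₗ[ℂ] (Fin (min n k) → ℂ) :=
    { toFun := fun w i => w.1 ⟨i, by omega⟩
      invFun := fun v => ⟨fun i => ex v i, by
        rw [hmem]; intro i hi; exact ex_ge _ (by omega)⟩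
      map_add' := fun _ _ => rfl
      map_smul' := fun _ _ => rfl
      left_inv := by
        rintro ⟨w, hw⟩
        ext i
        by_cases hi : (i : ℕ) < k
        · change ex (n := min n k) (fun i => w ⟨i, by omega⟩) (i : ℕ) = w i
          rw [ex_lt _ (by omega)]
        · change ex (n := min n k) (fun i => w ⟨i, by omega⟩) (i : ℕ) = w i
          rw [ex_ge _ (by omega)]
          exact ((hmem w).1 hw i (by omega)).symm
      right_inv := by
        intro v
        ext i
        exact ex_val v i }
  rw [e.finrank_eq, Module.finrank_fin_fun]

theorem shift_pow {n : ℕ} (S : Module.End ℂ (Fin n → ℂ)) (hS : ∀ w j, S w j = ex w (j + 1))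
    (k : ℕ) (w : Fin n → ℂ) (j : Fin n) : (S ^ k) w j = ex w (j + k) := by
  induction k generalizing j with
  | zero => simp [ex_val]
  | succ k ih =>
    rw [pow_succ', Module.End.mul_apply, hS]
    by_cases hj : (j : ℕ) + 1 < n
    · rw [ex_lt _ hj, ih]
      congr 1
      simp only []
      omega
    · rw [ex_ge _ (by omega), ex_ge _ (by omega)]

theorem shift_nil {n : ℕ} (S : Module.End ℂ (Fin n → ℂ)) (hS : ∀ w j, S w j = ex w (j + 1)) :
    S ^ n = 0 := by
  apply LinearMap.ext
  intro w
  ext j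
  rw [shift_pow S hS, ex_ge _ (by omega)]; rfl

theorem S1 (m : ℕ) (l : ℂ) (w : Fin (m + 1) → ℂ) (j : Fin (m + 1)) :
    NN (f1 m) (g1 m l) l w j = ex w (j + 1) := by
  rw [NN_apply, t1_f, Pi.sub_apply, t1_g]; simp

theorem S1' (m : ℕ) (l : ℂ) (w : Fin (m + 1) → ℂ) (j : Fin (m + 1)) :
    NN (g1 m l) (f1 m) l w j = ex w (j + 1) := by
  rw [NN_apply, t1_f, Pi.sub_apply, t1_g]; simp

theorem S4 (m : ℕ) (w : Fin m → ℂ) (j : Fin m) :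
    NN (f4 m) (g4 m) 0 w j = ex w (j + 1) := by
  rw [NN_apply, zero_smul, sub_zero, t4_g, ex_lt _ (by omega), t4_f]

theorem S4' (m : ℕ) (w : Fin (m + 1) → ℂ) (j : Fin (m + 1)) :
    NN (g4 m) (f4 m) 0 w j = ex w (j + 1) := by
  rw [NN_apply, zero_smul, sub_zero, t4_f]
  by_cases hj : (j : ℕ) < m
  · rw [ex_lt _ hj, t4_g]
  · rw [ex_ge _ (by omega), ex_ge _ (by omega)]

theorem A1 (m : ℕ) (l : ℂ) (k : ℕ) : k0 (f1 m) (g1 m l) l k = (min (m + 1) k : ℕ) := by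
  unfold k0
  rw [finrank_shift _ (shift_pow _ (S1 m l) k) (by omega)]

theorem A2 (m : ℕ) (l : ℂ) (k : ℕ) : k0 (g1 m l) (f1 m) l k = (min (m + 1) k : ℕ) := by
  unfold k0
  rw [finrank_shift _ (shift_pow _ (S1' m l) k) (by omega)]

theorem A3 (m k : ℕ) : k1 (f1 m) (g1 m 0) k = (min (m + 1) k : ℕ) := by
  unfold k1
  rw [finrank_shift (k := k) _ ?_ (by omega)]
  intro w j
  rw [LinearMap.comp_apply, t1_f, shift_pow _ (S1 m 0)]

theorem A4 (m k : ℕ) : k1 (g1 m 0) (f1 m) k = (min (m + 1) (k + 1) : ℕ) := by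
  unfold k1
  rw [finrank_shift (k := k + 1) _ ?_ (by omega)]
  intro w j
  rw [LinearMap.comp_apply, ← shift_pow _ (S1' m 0), pow_succ', Module.End.mul_apply, NN_apply,
    t1_f, zero_smul, sub_zero]

theorem B1 (m k : ℕ) : k0 (f4 m) (g4 m) 0 k = (min m k : ℕ) := by
  unfold k0
  rw [finrank_shift _ (shift_pow _ (S4 m) k) (by omega)]

theorem B2 (m k : ℕ) : k0 (g4 m) (f4 m) 0 k = (min (m + 1) k : ℕ) := by
  unfold k0
  rw [finrank_shift _ (shift_pow _ (S4' m) k) (by omega)]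

theorem B3 (m k : ℕ) : k1 (f4 m) (g4 m) k = (min m k : ℕ) := by
  unfold k1
  rw [finrank_shift (k := k) _ ?_ (by omega)]
  intro w j
  rw [LinearMap.comp_apply, t4_f]
  by_cases hj : (j : ℕ) < m
  · rw [ex_lt _ hj, shift_pow _ (S4 m)]
  · rw [ex_ge _ (by omega), ex_ge _ (by omega)]

theorem B4 (m k : ℕ) : k1 (g4 m) (f4 m) k = (min (m + 1) (k + 1) : ℕ) := by
  unfold k1
  rw [finrank_shift (k := k + 1) _ ?_ (by omega)]
  intro w j
  rw [LinearMap.comp_apply, t4_g, ex_lt _ (by omega), shift_pow _ (S4' m)]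
  congr 1
  simp only []
  omega

section mu
variable {U V U' V' : Type} [AddCommGroup U] [Module ℂ U] [AddCommGroup V] [Module ℂ V]
    [AddCommGroup U'] [Module ℂ U'] [AddCommGroup V'] [Module ℂ V']

open Classical in
/-- the multiplicity of a canonical block -/
noncomputable def mu (c : Idx) (f : U →ₗ[ℂ] V) (g : V →ₗ[ℂ] U) : ℤ :=
  match c with
  | .t1 m l => if l = 0 then k0 f g 0 (m + 1) - k1 f g m - k1 g f (m + 1) + k0 g f 0 (m + 1)
      else 2 * k0 f g l (m + 1) - k0 f g l m - k0 f g l (m + 2)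
  | .t2 m => k0 g f 0 (m + 1) - k1 g f m - k1 f g (m + 1) + k0 f g 0 (m + 1)
  | .t3 m => k1 f g m - k0 f g 0 m - k0 g f 0 (m + 1) + k1 g f m
  | .t4 m => k1 g f m - k0 g f 0 m - k0 f g 0 (m + 1) + k1 f g m

theorem mu_iso {f : U →ₗ[ℂ] V} {g : V →ₗ[ℂ] U} {f' : U' →ₗ[ℂ] V'} {g' : V' →ₗ[ℂ] U'}
    (h : Iso f g f' g') (c : Idx) : mu c f g = mu c f' g' := by
  cases c <;> simp only [mu, h.k0_eq, h.k1_eq, h.swap.k0_eq, h.swap.k1_eq]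

theorem mu_prod [FiniteDimensional ℂ U] [FiniteDimensional ℂ U'] [FiniteDimensional ℂ V]
    [FiniteDimensional ℂ V'] (f : U →ₗ[ℂ] V) (g : V →ₗ[ℂ] U) (f' : U' →ₗ[ℂ] V') (g' : V' →ₗ[ℂ] U')
    (c : Idx) : mu c (f.prodMap f') (g.prodMap g') = mu c f g + mu c f' g' := by
  cases c <;> simp only [mu, k0_prod, k1_prod] <;> (try split_ifs) <;> ring

theorem mu_sub [Subsingleton U] [Subsingleton V] (f : U →ₗ[ℂ] V) (g : V →ₗ[ℂ] U) (c : Idx) :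
    mu c f g = 0 := by
  cases c <;> simp [mu, k0, k1, Module.finrank_zero_of_subsingleton]
end mu

open Classical in
theorem mu_t1 (c : Idx) (m : ℕ) (l : ℂ) :
    mu c (f1 m) (g1 m l) = if Idx.t1 m l = c then 1 else 0 := by
  by_cases hl : l = 0
  · subst hl
    cases c with
    | t1 m' l' =>
      simp only [mu, Idx.t1.injEq]
      by_cases hl' : l' = 0
      · subst hl'
        simp only [if_true, A1, A2, A3, A4, and_true]
        split_ifs <;> omega
      · simp only [hl', if_false, Ne.symm hl', and_false,
          k0_zero_of_nil (Ne.symm hl') (shift_nil _ (S1 m 0))]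
        simp
    | t2 m' => simp only [mu, A1, A2, A3, A4, reduceCtorEq, if_false]; omega
    | t3 m' => simp only [mu, A1, A2, A3, A4, reduceCtorEq, if_false]; omega
    | t4 m' => simp only [mu, A1, A2, A3, A4, reduceCtorEq, if_false]; omega
  · have z1 := k0_zero_of_nil hl (shift_nil _ (S1 m l))
    have z2 := k0_zero_of_nil hl (shift_nil _ (S1' m l))
    have z3 := k1_zero_of_nil hl (shift_nil _ (S1 m l))
    have z4 := k1_zero_of_nil hl (shift_nil _ (S1' m l))
    cases c with
    | t1 m' l' =>
      simp only [mu, Idx.t1.injEq]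
      by_cases hl' : l' = 0
      · subst hl'
        simp [z1, z2, z3, z4, hl]
      · by_cases he : l = l'
        · subst he
          simp only [hl, if_false, A1, and_true]
          split_ifs <;> omega
        · simp [hl', he, k0_zero_of_nil he (shift_nil _ (S1 m l))]
    | t2 m' => simp [mu, z1, z2, z3, z4]
    | t3 m' => simp [mu, z1, z2, z3, z4]
    | t4 m' => simp [mu, z1, z2, z3, z4]

open Classical in
theorem mu_t2 (c : Idx) (m : ℕ) :
    mu c (g1 m 0) (f1 m) = if Idx.t2 m = c then 1 else 0 := by
  cases c with
  | t1 m' l' =>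
    by_cases hl' : l' = 0
    · subst hl'
      simp only [mu, if_true, A1, A2, A3, A4, reduceCtorEq, if_false]
      omega
    · simp [mu, hl', k0_zero_of_nil (Ne.symm hl') (shift_nil _ (S1' m 0))]
  | t2 m' => simp only [mu, A1, A2, A3, A4, Idx.t2.injEq]; split_ifs <;> omega
  | t3 m' => simp only [mu, A1, A2, A3, A4, reduceCtorEq, if_false]; omega
  | t4 m' => simp only [mu, A1, A2, A3, A4, reduceCtorEq, if_false]; omega

open Classical in
theorem mu_t3 (c : Idx) (m : ℕ) :
    mu c (f3 m) (g3 m) = if Idx.t3 m = c then 1 else 0 := by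
  rw [mu_iso (t4_swap m).swap]
  cases c with
  | t1 m' l' =>
    by_cases hl' : l' = 0
    · subst hl'
      simp only [mu, if_true, B1, B2, B3, B4, reduceCtorEq, if_false]
      omega
    · simp [mu, hl', k0_zero_of_nil (Ne.symm hl') (shift_nil _ (S4' m))]
  | t2 m' => simp only [mu, B1, B2, B3, B4, reduceCtorEq, if_false]; omega
  | t3 m' => simp only [mu, B1, B2, B3, B4, Idx.t3.injEq]; split_ifs <;> omega
  | t4 m' => simp only [mu, B1, B2, B3, B4, reduceCtorEq, if_false]; omega

open Classical in
theorem mu_t4 (c : Idx) (m : ℕ) :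
    mu c (f4 m) (g4 m) = if Idx.t4 m = c then 1 else 0 := by
  cases c with
  | t1 m' l' =>
    by_cases hl' : l' = 0
    · subst hl'
      simp only [mu, if_true, B1, B2, B3, B4, reduceCtorEq, if_false]
      omega
    · simp [mu, hl', k0_zero_of_nil (Ne.symm hl') (shift_nil _ (S4 m))]
  | t2 m' => simp only [mu, B1, B2, B3, B4, reduceCtorEq, if_false]; omega
  | t3 m' => simp only [mu, B1, B2, B3, B4, reduceCtorEq, if_false]; omega
  | t4 m' => simp only [mu, B1, B2, B3, B4, Idx.t4.injEq]; split_ifs <;> omega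

open Classical in
theorem mu_pair (c d : Idx) : mu c (lf d.toPair) (lg d.toPair) = if d = c then 1 else 0 := by
  cases d with
  | t1 m l => exact mu_t1 c m l
  | t2 m => exact mu_t2 c m
  | t3 m => exact mu_t3 c m
  | t4 m => exact mu_t4 c m

open Classical in
theorem mu_list (c : Idx) (L : List Idx) :
    mu c (lf (ContraPair.dsumList (L.map Idx.toPair)))
      (lg (ContraPair.dsumList (L.map Idx.toPair))) = L.count c := by
  induction L with
  | nil =>
    have : Subsingleton (Fin (ContraPair.dsumList (([] : List Idx).map Idx.toPair)).p → ℂ) :=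
      inferInstanceAs (Subsingleton (Fin 0 → ℂ))
    have : Subsingleton (Fin (ContraPair.dsumList (([] : List Idx).map Idx.toPair)).q → ℂ) :=
      inferInstanceAs (Subsingleton (Fin 0 → ℂ))
    rw [mu_sub]; simp
  | cons d L ih =>
    have h := mu_iso (dsum_iso d.toPair (ContraPair.dsumList (L.map Idx.toPair))) c
    rw [mu_prod, ih, mu_pair] at h
    refine h.symm.trans ?_
    rw [List.count_cons]
    simp only [beq_iff_eq]
    split_ifs <;> push_cast <;> ring

end CCF

/-- Dobrovol′skaya–Ponomarev: every pair `(A, B)` with `A` of size `p × q` and `B` of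
size `q × p` is contragrediently equivalent to a direct sum of canonical pairs, and
the multiset of canonical summands is uniquely determined. -/
theorem contragredient_canonical_form (p q : ℕ)
    (A : Matrix (Fin p) (Fin q) ℂ) (B : Matrix (Fin q) (Fin p) ℂ) :
    ∃ L : List ContraPair,
      (∀ P ∈ L, ContraCanonical P) ∧
      ContraPair.ContraEquiv ⟨p, q, A, B⟩ (ContraPair.dsumList L) ∧
      ∀ L' : List ContraPair, (∀ P ∈ L', ContraCanonical P) →
        ContraPair.ContraEquiv ⟨p, q, A, B⟩ (ContraPair.dsumList L') →
        (L : Multiset ContraPair) = (L' : Multiset ContraPair) := by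
  obtain ⟨L, hL⟩ := CCF.exists_list _ _ _ (CCF.lf ⟨p, q, A, B⟩) (CCF.lg ⟨p, q, A, B⟩) rfl
  refine ⟨L.map CCF.Idx.toPair, ?_, (CCF.equiv_iff _ _).2 hL, ?_⟩
  · intro P hP
    obtain ⟨c, -, rfl⟩ := List.mem_map.1 hP
    exact c.canon
  · intro L' hc hL'
    obtain ⟨L0, rfl⟩ := CCF.canon_list L' hc
    rw [CCF.equiv_iff] at hL'
    have hp : L.Perm L0 := by
      classical
      rw [List.perm_iff_count]
      intro c
      have h := CCF.mu_iso (hL.symm.trans hL') c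
      rw [CCF.mu_list, CCF.mu_list] at h
      exact_mod_cast h
    exact Multiset.coe_eq_coe.2 (hp.map _)
end
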